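/- arXiv:1303.3993 — 2 statements merged into one kernel-verified Lean document; each statement's English description precedes it below -/
import Mathlib

section
/- There is an absolute constant C > 0 (the proof yields C = 2·120·2^12·300 + 4 = 294912004) such that for every function f : ℤ → ℝ of bounded variation, the discrete centered Hardy–Littlewood maximal function satisfies Var(Mf) ≤ C · Var f. -/
open Finset

noncomputable section

/-- Average of `f : ℤ → ℝ` over the integer interval `[x, y]`:
`A_{x,y} f = (1/(y-x+1)) ∑_{k=x}^{y} f(k)`. -/
def avg (f : ℤ → ℝ) (x y : ℤ) : ℝ :=
  (∑ k ∈ Finset.Icc x y, f k) / ((y - x + 1 : ℤ) : ℝ)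

/-- The discrete centered Hardy–Littlewood maximal function
`Mf(n) = sup_{r ≥ 0} (1/(2r+1)) ∑_{k=-r}^{r} |f(n+k)|`. -/
def dM (f : ℤ → ℝ) (n : ℤ) : ℝ :=
  ⨆ r : ℕ, avg (fun k => |f k|) (n - r) (n + r)

/-- The total variation `Var f = ∑_{k ∈ ℤ} |f(k+1) - f(k)|`. -/
def dVar (f : ℤ → ℝ) : ℝ := ∑' k : ℤ, |f (k + 1) - f k|

/-- `f` has bounded variation. -/
def BddVar (f : ℤ → ℝ) : Prop := Summable fun k : ℤ => |f (k + 1) - f k|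

/-- A peak for `f`: integers `p < r < q` with `Mf(p) < Mf(r)` and `Mf(q) < Mf(r)`. -/
def IsPeak (f : ℤ → ℝ) (p r q : ℤ) : Prop :=
  p < r ∧ r < q ∧ dM f p < dM f r ∧ dM f q < dM f r

/-- The variation of a peak `{p < r < q}`: `2·Mf(r) - Mf(p) - Mf(q)`. -/
def peakVar (f : ℤ → ℝ) (p r q : ℤ) : ℝ := 2 * dM f r - dM f p - dM f q

/-- An essential peak: `max_{p<k<q} f(k) ≤ Mf(r) - (1/4)·Var{p,r,q}`. -/
def IsEssentialPeak (f : ℤ → ℝ) (p r q : ℤ) : Prop :=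
  IsPeak f p r q ∧
    ∀ k : ℤ, p < k → k < q → f k ≤ dM f r - (1 / 4) * peakVar f p r q

/-- `w` is the radius `ω(r)` of an (essential) peak with center `r`:
the largest integer `w > 0` with `A_w f(r) = Mf(r)`. -/
def IsRadius (f : ℤ → ℝ) (r w : ℤ) : Prop :=
  0 < w ∧ avg f (r - w) (r + w) = dM f r ∧
    ∀ w' : ℤ, 0 < w' → avg f (r - w') (r + w') = dM f r → w' ≤ w

/-! ### Window lemmas -/

lemma exists_ge_of_sum {u : ℤ → ℝ} {s : Finset ℤ} {c : ℝ} (hs : s.Nonempty)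
    (h : (s.card : ℝ) * c ≤ ∑ k ∈ s, u k) : ∃ y ∈ s, c ≤ u y := by
  by_contra hc
  push Not at hc
  have := Finset.sum_lt_sum_of_nonempty hs hc
  rw [Finset.sum_const, nsmul_eq_mul] at this
  linarith

lemma exists_le_of_sum {u : ℤ → ℝ} {s : Finset ℤ} {c : ℝ} (hs : s.Nonempty)
    (h : ∑ k ∈ s, u k ≤ (s.card : ℝ) * c) : ∃ y ∈ s, u y ≤ c := by
  by_contra hc
  push Not at hc
  have := Finset.sum_lt_sum_of_nonempty hs hc
  rw [Finset.sum_const, nsmul_eq_mul] at this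
  linarith

lemma sum_Ico_split (u : ℤ → ℝ) {x y z : ℤ} (h1 : x ≤ y) (h2 : y ≤ z) :
    ∑ k ∈ Finset.Ico x z, u k = ∑ k ∈ Finset.Ico x y, u k + ∑ k ∈ Finset.Ico y z, u k := by
  rw [← Finset.sum_union (Finset.Ico_disjoint_Ico_consecutive x y z),
    Finset.Ico_union_Ico_eq_Ico h1 h2]

/-- `g` dominates all centered averages of `u`. -/
def Dom (u g : ℤ → ℝ) : Prop :=
  ∀ n w : ℤ, 0 ≤ w → ∑ k ∈ Finset.Ico (n - w) (n + w + 1), u k ≤ (2 * w + 1) * g n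

/-- `g r` is attained with radius `w`. -/
def Att (u g : ℤ → ℝ) (r w : ℤ) : Prop :=
  0 ≤ w ∧ ∑ k ∈ Finset.Ico (r - w) (r + w + 1), u k = (2 * w + 1) * g r

lemma Dom.le {u g : ℤ → ℝ} (h : Dom u g) (n : ℤ) : u n ≤ g n := by
  have := h n 0 le_rfl
  have e : Finset.Ico n (n + 1) = {n} := by
    ext x; simp only [Finset.mem_Ico, Finset.mem_singleton]; omega
  simpa [e] using this

lemma win_Lp {u g : ℤ → ℝ} (hd : Dom u g) {r w x : ℤ} (ha : Att u g r w) (hx : r < x)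
    (hxw : x ≤ r + w) {D : ℝ}
    (hD : 2 * ((x : ℝ) - r) * D ≤ (2 * w - 2 * ((x : ℝ) - r) + 1) * (g r - g x)) :
    ∃ y, r - w ≤ y ∧ y < r - w + 2 * (x - r) ∧ g r + D ≤ u y := by
  have h1 := hd x (w - (x - r)) (by linarith)
  have e1 : x - (w - (x - r)) = r - w + 2 * (x - r) := by ring
  have e2 : x + (w - (x - r)) + 1 = r + w + 1 := by ring
  rw [e1, e2] at h1
  have h2 := sum_Ico_split u (x := r - w) (y := r - w + 2 * (x - r)) (z := r + w + 1)
    (by linarith) (by linarith)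
  rw [ha.2] at h2
  obtain ⟨y, hy, hy2⟩ := exists_ge_of_sum (u := u) (c := g r + D)
    (s := Finset.Ico (r - w) (r - w + 2 * (x - r))) (by
      rw [Finset.nonempty_Ico]; linarith) (by
      have : ((Finset.Ico (r - w) (r - w + 2 * (x - r))).card : ℝ) = 2 * ((x : ℝ) - r) := by
        have : ((Finset.Ico (r - w) (r - w + 2 * (x - r))).card : ℤ) = 2 * (x - r) := by
          rw [Int.card_Ico_of_le _ _ (by linarith)]; ring
        exact_mod_cast this
      rw [this]
      push_cast at h1
      nlinarith)
  rw [Finset.mem_Ico] at hy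
  exact ⟨y, hy.1, hy.2, hy2⟩

lemma win_Rp {u g : ℤ → ℝ} (hd : Dom u g) {r w x : ℤ} (ha : Att u g r w) (hx : r < x)
    {D : ℝ}
    (hD : 2 * ((x : ℝ) - r) * D ≤ (2 * w + 2 * ((x : ℝ) - r) + 1) * (g r - g x)) :
    ∃ y, r + w + 1 ≤ y ∧ y < r + w + 1 + 2 * (x - r) ∧ u y ≤ g r - D := by
  have hw := ha.1
  have h1 := hd x (w + (x - r)) (by linarith)
  have e1 : x - (w + (x - r)) = r - w := by ring
  have e2 : x + (w + (x - r)) + 1 = r + w + 1 + 2 * (x - r) := by ring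
  rw [e1, e2] at h1
  have h2 := sum_Ico_split u (x := r - w) (y := r + w + 1) (z := r + w + 1 + 2 * (x - r))
    (by linarith) (by linarith)
  rw [ha.2] at h2
  obtain ⟨y, hy, hy2⟩ := exists_le_of_sum (u := u) (c := g r - D)
    (s := Finset.Ico (r + w + 1) (r + w + 1 + 2 * (x - r))) (by
      rw [Finset.nonempty_Ico]; linarith) (by
      have : ((Finset.Ico (r + w + 1) (r + w + 1 + 2 * (x - r))).card : ℝ)
          = 2 * ((x : ℝ) - r) := by
        have : ((Finset.Ico (r + w + 1) (r + w + 1 + 2 * (x - r))).card : ℤ)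
            = 2 * (x - r) := by
          rw [Int.card_Ico_of_le _ _ (by linarith)]; ring
        exact_mod_cast this
      rw [this]
      push_cast at h1
      nlinarith)
  rw [Finset.mem_Ico] at hy
  exact ⟨y, hy.1, hy.2, hy2⟩

lemma win_Rm {u g : ℤ → ℝ} (hd : Dom u g) {r w x : ℤ} (ha : Att u g r w) (hx : x < r)
    (hxw : r ≤ x + w) {D : ℝ}
    (hD : 2 * ((r : ℝ) - x) * D ≤ (2 * w - 2 * ((r : ℝ) - x) + 1) * (g r - g x)) :
    ∃ y, r + w + 1 - 2 * (r - x) ≤ y ∧ y < r + w + 1 ∧ g r + D ≤ u y := by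
  have h1 := hd x (w - (r - x)) (by linarith)
  have e1 : x - (w - (r - x)) = r - w := by ring
  have e2 : x + (w - (r - x)) + 1 = r + w + 1 - 2 * (r - x) := by ring
  rw [e1, e2] at h1
  have h2 := sum_Ico_split u (x := r - w) (y := r + w + 1 - 2 * (r - x)) (z := r + w + 1)
    (by linarith) (by linarith)
  rw [ha.2] at h2
  obtain ⟨y, hy, hy2⟩ := exists_ge_of_sum (u := u) (c := g r + D)
    (s := Finset.Ico (r + w + 1 - 2 * (r - x)) (r + w + 1)) (by
      rw [Finset.nonempty_Ico]; linarith) (by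
      have : ((Finset.Ico (r + w + 1 - 2 * (r - x)) (r + w + 1)).card : ℝ)
          = 2 * ((r : ℝ) - x) := by
        have : ((Finset.Ico (r + w + 1 - 2 * (r - x)) (r + w + 1)).card : ℤ)
            = 2 * (r - x) := by
          rw [Int.card_Ico_of_le _ _ (by linarith)]; ring
        exact_mod_cast this
      rw [this]
      push_cast at h1
      nlinarith)
  rw [Finset.mem_Ico] at hy
  exact ⟨y, hy.1, hy.2, hy2⟩

lemma win_Lm {u g : ℤ → ℝ} (hd : Dom u g) {r w x : ℤ} (ha : Att u g r w) (hx : x < r)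
    {D : ℝ}
    (hD : 2 * ((r : ℝ) - x) * D ≤ (2 * w + 2 * ((r : ℝ) - x) + 1) * (g r - g x)) :
    ∃ y, r - w - 2 * (r - x) ≤ y ∧ y < r - w ∧ u y ≤ g r - D := by
  have hw := ha.1
  have h1 := hd x (w + (r - x)) (by linarith)
  have e1 : x - (w + (r - x)) = r - w - 2 * (r - x) := by ring
  have e2 : x + (w + (r - x)) + 1 = r + w + 1 := by ring
  rw [e1, e2] at h1
  have h2 := sum_Ico_split u (x := r - w - 2 * (r - x)) (y := r - w) (z := r + w + 1)
    (by linarith) (by linarith)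
  rw [ha.2] at h2
  obtain ⟨y, hy, hy2⟩ := exists_le_of_sum (u := u) (c := g r - D)
    (s := Finset.Ico (r - w - 2 * (r - x)) (r - w)) (by
      rw [Finset.nonempty_Ico]; linarith) (by
      have : ((Finset.Ico (r - w - 2 * (r - x)) (r - w)).card : ℝ)
          = 2 * ((r : ℝ) - x) := by
        have : ((Finset.Ico (r - w - 2 * (r - x)) (r - w)).card : ℤ)
            = 2 * (r - x) := by
          rw [Int.card_Ico_of_le _ _ (by linarith)]; ring
        exact_mod_cast this
      rw [this]
      push_cast at h1
      nlinarith)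
  rw [Finset.mem_Ico] at hy
  exact ⟨y, hy.1, hy.2, hy2⟩

/-! ### Crossings and active levels -/

/-- The level `l` is crossed between `c` and `c + 1`. -/
def Crs (u : ℤ → ℝ) (l : ℝ) (c : ℤ) : Prop := ¬ (l < u c ↔ l < u (c + 1))

lemma exists_crs {u : ℤ → ℝ} {l : ℝ} {x y : ℤ} (hxy : x ≤ y)
    (h : ¬ (l < u x ↔ l < u y)) : ∃ c, x ≤ c ∧ c < y ∧ Crs u l c := by
  induction y, hxy using Int.leInduction with
  | base => exact absurd Iff.rfl h
  | succ n hn ih =>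
    by_cases h1 : (l < u x ↔ l < u n)
    · exact ⟨n, hn, by linarith, fun h2 => h (h1.trans h2)⟩
    · obtain ⟨c, hc⟩ := ih h1
      exact ⟨c, hc.1, by linarith, hc.2.2⟩

lemma exists_crs_min {u : ℤ → ℝ} {l : ℝ} {x y : ℤ}
    (h1 : l < u x) (h2 : u y ≤ l) : ∃ c, min x y ≤ c ∧ c < max x y ∧ Crs u l c := by
  rcases le_total x y with h | h
  · rw [min_eq_left h, max_eq_right h]
    exact exists_crs h (fun h3 => by linarith [h3.1 h1])
  · rw [min_eq_right h, max_eq_left h]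
    exact exists_crs h (fun h3 => by linarith [h3.2 h1])

/-- The level `l` is active at scale `N` near `m`. -/
def Act (u : ℤ → ℝ) (N : ℕ) (m : ℤ) (l : ℝ) : Prop :=
  ∃ c c' : ℤ, Crs u l c ∧ Crs u l c' ∧ (2 : ℤ) ^ N ≤ 64 * (c' - c) ∧
    m - 4 * 2 ^ N ≤ c ∧ c' ≤ m + 4 * 2 ^ N

/-- Small cell: levels between the value at a center and at a nearby point are active. -/
lemma act_right {u g : ℤ → ℝ} (hd : Dom u g) {N : ℕ} {m r w p x : ℤ} {l : ℝ}
    (ha : Att u g r w) (hw1 : 2 ^ N ≤ w) (hw2 : w < 2 * 2 ^ N) (hm : m ≤ r)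
    (hm2 : r < m + 2 ^ N) (hp : p < r) (hp2 : 8 * (r - p) ≤ 2 ^ N) (hgp : g p ≤ g r)
    (hx : r < x) (hx2 : 8 * (x - r) ≤ 2 ^ N) (h1 : g x < l) (h2 : l < g r) :
    Act u N m l := by
  have hxr : (0 : ℝ) < (x : ℝ) - r := by exact_mod_cast sub_pos.2 hx
  have hpr : (0 : ℝ) < (r : ℝ) - p := by exact_mod_cast sub_pos.2 hp
  have hN : (0 : ℤ) < 2 ^ N := by positivity
  have hwx : (x : ℝ) - r ≤ w := by
    have : x - r ≤ w := by linarith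
    exact_mod_cast this
  have hwp : (r : ℝ) - p ≤ w := by
    have : r - p ≤ w := by linarith
    exact_mod_cast this
  obtain ⟨y, hy1, hy2, hy3⟩ := win_Lp hd ha hx (by linarith) (D := 0) (by
    rw [mul_zero]; apply mul_nonneg <;> linarith)
  obtain ⟨z, hz1, hz2, hz3⟩ := win_Rp hd ha hx (D := g r - g x) (by
    apply mul_le_mul_of_nonneg_right <;> linarith)
  obtain ⟨y', hy1', hy2', hy3'⟩ := win_Rm hd ha hp (by linarith) (D := 0) (by
    rw [mul_zero]; apply mul_nonneg <;> linarith)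
  have hux := hd.le x
  obtain ⟨c, hc1, hc2, hc3⟩ := exists_crs (u := u) (l := l) (x := y) (y := x) (by linarith)
    (fun h => by linarith [h.1 (by linarith)])
  obtain ⟨c', hc1', hc2', hc3'⟩ := exists_crs (u := u) (l := l) (x := y') (y := z) (by linarith)
    (fun h => by linarith [h.1 (by linarith)])
  exact ⟨c, c', hc3, hc3', by linarith, by linarith, by linarith⟩

lemma act_left {u g : ℤ → ℝ} (hd : Dom u g) {N : ℕ} {m r w q x : ℤ} {l : ℝ}
    (ha : Att u g r w) (hw1 : 2 ^ N ≤ w) (hw2 : w < 2 * 2 ^ N) (hm : m ≤ r)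
    (hm2 : r < m + 2 ^ N) (hq : r < q) (hq2 : 8 * (q - r) ≤ 2 ^ N) (hgq : g q ≤ g r)
    (hx : x < r) (hx2 : 8 * (r - x) ≤ 2 ^ N) (h1 : g x < l) (h2 : l < g r) :
    Act u N m l := by
  have hxr : (0 : ℝ) < (r : ℝ) - x := by exact_mod_cast sub_pos.2 hx
  have hpr : (0 : ℝ) < (q : ℝ) - r := by exact_mod_cast sub_pos.2 hq
  have hN : (0 : ℤ) < 2 ^ N := by positivity
  have hwx : (r : ℝ) - x ≤ w := by
    have : r - x ≤ w := by linarith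
    exact_mod_cast this
  have hwp : (q : ℝ) - r ≤ w := by
    have : q - r ≤ w := by linarith
    exact_mod_cast this
  obtain ⟨y, hy1, hy2, hy3⟩ := win_Rm hd ha hx (by linarith) (D := 0) (by
    rw [mul_zero]; apply mul_nonneg <;> linarith)
  obtain ⟨z, hz1, hz2, hz3⟩ := win_Lm hd ha hx (D := g r - g x) (by
    apply mul_le_mul_of_nonneg_right <;> linarith)
  obtain ⟨y', hy1', hy2', hy3'⟩ := win_Lp hd ha hq (by linarith) (D := 0) (by
    rw [mul_zero]; apply mul_nonneg <;> linarith)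
  have hux := hd.le x
  obtain ⟨c, hc1, hc2, hc3⟩ := exists_crs (u := u) (l := l) (x := x) (y := y) (by linarith)
    (fun h => by linarith [h.2 (by linarith)])
  obtain ⟨c', hc1', hc2', hc3'⟩ := exists_crs (u := u) (l := l) (x := z) (y := y') (by linarith)
    (fun h => by linarith [h.2 (by linarith)])
  exact ⟨c', c, hc3', hc3, by linarith, by linarith, by linarith⟩

/-- Levels active because of one steep descent and one steep ascent. -/
lemma act_two {u g : ℤ → ℝ} (hd : Dom u g) {N : ℕ} {m r w x r' w' x' : ℤ} {l D : ℝ}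
    (ha : Att u g r w) (hw1 : 2 ^ N ≤ w) (hw2 : w < 2 * 2 ^ N) (hm : m ≤ r)
    (hm2 : 16 * (r - m) ≤ 2 ^ N)
    (ha' : Att u g r' w') (hw1' : 2 ^ N ≤ w') (hw2' : w' < 2 * 2 ^ N) (hm' : m ≤ r')
    (hm2' : 16 * (r' - m) ≤ 2 ^ N)
    (hx : r < x) (hx2 : 8 * (x - r) ≤ 2 ^ N)
    (hx' : x' < r') (hx2' : 8 * (r' - x') ≤ 2 ^ N) (hD : 0 ≤ D)
    (hs : 2 * D / 2 ^ N * ((x : ℝ) - r) ≤ g r - g x)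
    (hs' : 2 * D / 2 ^ N * ((r' : ℝ) - x') ≤ g r' - g x')
    (h1 : g r - D < l) (h2 : g r' - D < l) (h3 : l < g r + D) (h4 : l < g r' + D) :
    Act u N m l := by
  have hxr : (0 : ℝ) < (x : ℝ) - r := by exact_mod_cast sub_pos.2 hx
  have hxr' : (0 : ℝ) < (r' : ℝ) - x' := by exact_mod_cast sub_pos.2 hx'
  have hN : (0 : ℤ) < 2 ^ N := by positivity
  have hNr : (0 : ℝ) < 2 ^ N := by positivity
  have hwx : (2 : ℝ) ^ N ≤ 2 * w - 2 * ((x : ℝ) - r) + 1 := by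
    have : (2 : ℤ) ^ N ≤ 2 * w - 2 * (x - r) + 1 := by linarith
    exact_mod_cast this
  have hwx' : (2 : ℝ) ^ N ≤ 2 * w' - 2 * ((r' : ℝ) - x') + 1 := by
    have : (2 : ℤ) ^ N ≤ 2 * w' - 2 * (r' - x') + 1 := by linarith
    exact_mod_cast this
  have k1 : 2 * ((x : ℝ) - r) * D ≤ 2 ^ N * (g r - g x) := by
    calc 2 * ((x : ℝ) - r) * D = 2 ^ N * (2 * D / 2 ^ N * ((x : ℝ) - r)) := by
          field_simp
      _ ≤ _ := by gcongr
  have k1' : 2 * ((r' : ℝ) - x') * D ≤ 2 ^ N * (g r' - g x') := by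
    calc 2 * ((r' : ℝ) - x') * D = 2 ^ N * (2 * D / 2 ^ N * ((r' : ℝ) - x')) := by
          field_simp
      _ ≤ _ := by gcongr
  have p1 : 0 ≤ g r - g x := le_trans (by positivity) hs
  have p1' : 0 ≤ g r' - g x' := le_trans (by positivity) hs'
  obtain ⟨y, hy1, hy2, hy3⟩ := win_Lp hd ha hx (by linarith) (D := D) (by
    refine k1.trans ?_
    gcongr)
  obtain ⟨z, hz1, hz2, hz3⟩ := win_Rp hd ha hx (D := D) (by
    refine k1.trans ?_
    apply mul_le_mul_of_nonneg_right _ p1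
    linarith)
  obtain ⟨y', hy1', hy2', hy3'⟩ := win_Rm hd ha' hx' (by linarith) (D := D) (by
    refine k1'.trans ?_
    gcongr)
  obtain ⟨z', hz1', hz2', hz3'⟩ := win_Lm hd ha' hx' (D := D) (by
    refine k1'.trans ?_
    apply mul_le_mul_of_nonneg_right _ p1'
    linarith)
  obtain ⟨c, hc1, hc2, hc3⟩ := exists_crs_min (u := u) (l := l) (x := y) (y := z')
    (by linarith) (by linarith)
  obtain ⟨c', hc1', hc2', hc3'⟩ := exists_crs_min (u := u) (l := l) (x := y') (y := z)
    (by linarith) (by linarith)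
  refine ⟨c, c', hc3, hc3', ?_, ?_, ?_⟩
  · omega
  · omega
  · omega

/-! ### Small cells -/

lemma sum_down {g : ℤ → ℝ} {p q : ℤ → ℤ} {σ : ℝ} (hσ : 0 ≤ σ) (S : Finset ℤ) :
    S.Nonempty → (∀ r ∈ S, p r < r ∧ r < q r) →
    (∀ r ∈ S, ∀ r' ∈ S, r < r' → q r ≤ p r') →
    (∀ r ∈ S, g r - g (q r) ≤ σ * ((q r : ℝ) - r)) →
    (∀ r ∈ S, ∀ r' ∈ S, r < r' → g r - g (p r') ≤ σ * ((p r' : ℝ) - r)) →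
    ∃ r1 ∈ S, ∃ rn ∈ S, (∀ r ∈ S, r ≤ rn) ∧
      ∑ r ∈ S, (2 * g r - g (p r) - g (q r)) ≤
        g rn - g (p r1) + 2 * σ * ((rn : ℝ) - p r1) + σ * ((q rn : ℝ) - rn) := by
  induction S using Finset.induction_on_max with
  | empty => intro h; simp at h
  | insert a T ha ih =>
    intro _ h1 h2 h3 h4
    have haT : a ∉ T := fun h => lt_irrefl _ (ha a h)
    have ma : a ∈ insert a T := Finset.mem_insert_self _ _
    have hpa := h1 a ma
    have hqa := h3 a ma
    have hpar : (p a : ℝ) < a := by exact_mod_cast hpa.1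
    rcases T.eq_empty_or_nonempty with hT | hT
    · subst hT
      refine ⟨a, ma, a, ma, by simp, ?_⟩
      simp only [Finset.sum_insert haT, Finset.sum_empty]
      have : 0 ≤ 2 * σ * ((a : ℝ) - p a) := by
        apply mul_nonneg <;> linarith
      linarith
    · have mm : ∀ r ∈ T, r ∈ insert a T := fun r hr => Finset.mem_insert_of_mem hr
      obtain ⟨r1, hr1, b, hb, hbm, hsum⟩ := ih hT (fun r hr => h1 r (mm r hr))
        (fun r hr r' hr' => h2 r (mm r hr) r' (mm r' hr')) (fun r hr => h3 r (mm r hr))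
        (fun r hr r' hr' => h4 r (mm r hr) r' (mm r' hr'))
      refine ⟨r1, mm _ hr1, a, ma, ?_, ?_⟩
      · intro r hr
        rcases Finset.mem_insert.1 hr with h | h
        · exact h.le
        · exact (ha r h).le
      · rw [Finset.sum_insert haT]
        have k1 := h4 b (mm b hb) a ma (ha b hb)
        have k2 : (q b : ℝ) ≤ p a := by exact_mod_cast h2 b (mm b hb) a ma (ha b hb)
        nlinarith [mul_le_mul_of_nonneg_left k2 hσ, mul_le_mul_of_nonneg_left hpar.le hσ]

lemma sum_up {g : ℤ → ℝ} {p q : ℤ → ℤ} {σ : ℝ} (hσ : 0 ≤ σ) (S : Finset ℤ) :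
    S.Nonempty → (∀ r ∈ S, p r < r ∧ r < q r) →
    (∀ r ∈ S, ∀ r' ∈ S, r < r' → q r ≤ p r') →
    (∀ r ∈ S, g r - g (p r) ≤ σ * ((r : ℝ) - p r)) →
    (∀ r ∈ S, ∀ r' ∈ S, r < r' → g r' - g (q r) ≤ σ * ((r' : ℝ) - q r)) →
    ∃ r1 ∈ S, ∃ rn ∈ S, (∀ r ∈ S, r1 ≤ r) ∧
      ∑ r ∈ S, (2 * g r - g (p r) - g (q r)) ≤
        g r1 - g (q rn) + 2 * σ * ((q rn : ℝ) - r1) + σ * ((r1 : ℝ) - p r1) := by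
  induction S using Finset.induction_on_min with
  | empty => intro h; simp at h
  | insert a T ha ih =>
    intro _ h1 h2 h3 h4
    have haT : a ∉ T := fun h => lt_irrefl _ (ha a h)
    have ma : a ∈ insert a T := Finset.mem_insert_self _ _
    have hpa := h1 a ma
    have hqa := h3 a ma
    have hpar : (a : ℝ) < q a := by exact_mod_cast hpa.2
    rcases T.eq_empty_or_nonempty with hT | hT
    · subst hT
      refine ⟨a, ma, a, ma, by simp, ?_⟩
      simp only [Finset.sum_insert haT, Finset.sum_empty]
      have : 0 ≤ 2 * σ * ((q a : ℝ) - a) := by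
        apply mul_nonneg <;> linarith
      linarith
    · have mm : ∀ r ∈ T, r ∈ insert a T := fun r hr => Finset.mem_insert_of_mem hr
      obtain ⟨b, hb, rn, hrn, hbm, hsum⟩ := ih hT (fun r hr => h1 r (mm r hr))
        (fun r hr r' hr' => h2 r (mm r hr) r' (mm r' hr')) (fun r hr => h3 r (mm r hr))
        (fun r hr r' hr' => h4 r (mm r hr) r' (mm r' hr'))
      refine ⟨a, ma, rn, mm _ hrn, ?_, ?_⟩
      · intro r hr
        rcases Finset.mem_insert.1 hr with h | h
        · exact h.ge
        · exact (ha r h).le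
      · rw [Finset.sum_insert haT]
        have k1 := h4 a ma b (mm b hb) (ha b hb)
        have k2 : (q a : ℝ) ≤ p b := by exact_mod_cast h2 a ma b (mm b hb) (ha b hb)
        nlinarith [mul_le_mul_of_nonneg_left k2 hσ, mul_le_mul_of_nonneg_left hpar.le hσ]

lemma small_cell {u g : ℤ → ℝ} (hd : Dom u g) (S : Finset ℤ) (p q w : ℤ → ℤ) (N : ℕ) (m : ℤ)
    (M : ℝ) (hatt : ∀ r ∈ S, Att u g r (w r))
    (hw : ∀ r ∈ S, 2 ^ N ≤ w r ∧ w r < 2 * 2 ^ N)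
    (hm : ∀ r ∈ S, m ≤ r ∧ 16 * (r - m) ≤ 2 ^ N)
    (hpk : ∀ r ∈ S, p r < r ∧ r < q r ∧ g (p r) < g r ∧ g (q r) < g r)
    (hord : ∀ r ∈ S, ∀ r' ∈ S, r < r' → q r ≤ p r')
    (hsm : ∀ r ∈ S, 32 * (q r - p r) ≤ w r)
    (hM : ∀ α β, (∀ l, α < l → l < β → Act u N m l) → β - α ≤ M) :
    ∑ r ∈ S, (2 * g r - g (p r) - g (q r)) ≤ 3 * M := by
  have hM0 : 0 ≤ M := by
    have := hM 0 0 (fun l h1 h2 => absurd h1 (not_lt.2 h2.le))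
    simpa using this
  have hN : (0 : ℤ) < 2 ^ N := by positivity
  have hNr : (0 : ℝ) < 2 ^ N := by positivity
  have stepA : ∀ r ∈ S, ∀ x, 8 * (x - r) ≤ 2 ^ N → 8 * (r - x) ≤ 2 ^ N → g r - g x ≤ M := by
    intro r hr x hx1 hx2
    have a1 := hw r hr
    have a2 := hm r hr
    have a3 := hpk r hr
    have a4 := hsm r hr
    rcases lt_trichotomy x r with h | h | h
    · apply hM
      intro l hl1 hl2
      exact act_left hd (hatt r hr) a1.1 a1.2 a2.1 (by linarith) a3.2.1 (by linarith)
        a3.2.2.2.le h hx2 hl1 hl2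
    · subst h; simpa using hM0
    · apply hM
      intro l hl1 hl2
      exact act_right hd (hatt r hr) a1.1 a1.2 a2.1 (by linarith) a3.1 (by linarith)
        a3.2.2.1.le h hx1 hl1 hl2
  have near : ∀ r ∈ S, ∀ r' ∈ S, 8 * (q r' - r) ≤ 2 ^ N ∧ 8 * (r - p r') ≤ 2 ^ N ∧
      8 * (p r' - r) ≤ 2 ^ N ∧ 8 * (r - q r') ≤ 2 ^ N := by
    intro r hr r' hr'
    have a1 := hw r' hr'
    have a2 := hm r hr
    have a2' := hm r' hr'
    have a3 := hpk r' hr'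
    have a4 := hsm r' hr'
    refine ⟨by linarith, by linarith, by linarith, by linarith⟩
  have nearr : ∀ r ∈ S, ∀ r' ∈ S, 8 * ((q r' : ℝ) - r) ≤ 2 ^ N ∧ 8 * ((r : ℝ) - p r') ≤ 2 ^ N := by
    intro r hr r' hr'
    have := near r hr r' hr'
    exact ⟨by exact_mod_cast this.1, by exact_mod_cast this.2.1⟩
  rcases S.eq_empty_or_nonempty with hS | hS
  · subst hS; simp; linarith
  set σ : ℝ := 2 * (2 * M) / 2 ^ N with hσd
  have hσ : 0 ≤ σ := by positivity
  have hσN : σ * 2 ^ N = 4 * M := by rw [hσd]; field_simp; ring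
  by_cases hdown : ∀ r ∈ S, ∀ x : ℤ, r < x → 8 * (x - r) ≤ 2 ^ N →
      g r - g x ≤ σ * ((x : ℝ) - r)
  · obtain ⟨r1, hr1, rn, hrn, hmax, hsum⟩ := sum_down (g := g) hσ S hS
      (fun r hr => ⟨(hpk r hr).1, (hpk r hr).2.1⟩) hord
      (fun r hr => hdown r hr _ (hpk r hr).2.1 (near r hr r hr).1)
      (fun r hr r' hr' hrr => hdown r hr _ (lt_of_lt_of_le (hpk r hr).2.1 (hord r hr r' hr' hrr))
        (near r hr r' hr').2.2.1)
    have k1 := stepA rn hrn (p r1) (near rn hrn r1 hr1).2.2.1 (near rn hrn r1 hr1).2.1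
    have k2 := (nearr rn hrn r1 hr1).2
    have k3 := (nearr rn hrn rn hrn).1
    nlinarith [mul_le_mul_of_nonneg_left k2 hσ, mul_le_mul_of_nonneg_left k3 hσ]
  by_cases hup : ∀ r ∈ S, ∀ x : ℤ, x < r → 8 * (r - x) ≤ 2 ^ N →
      g r - g x ≤ σ * ((r : ℝ) - x)
  · obtain ⟨r1, hr1, rn, hrn, hmax, hsum⟩ := sum_up (g := g) hσ S hS
      (fun r hr => ⟨(hpk r hr).1, (hpk r hr).2.1⟩) hord
      (fun r hr => hup r hr _ (hpk r hr).1 (near r hr r hr).2.1)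
      (fun r hr r' hr' hrr => hup r' hr' _ (lt_of_le_of_lt (hord r hr r' hr' hrr) (hpk r' hr').1)
        (near r' hr' r hr).2.2.2)
    have k1 := stepA r1 hr1 (q rn) (near r1 hr1 rn hrn).1 (near r1 hr1 rn hrn).2.2.2
    have k2 := (nearr r1 hr1 rn hrn).1
    have k3 := (nearr r1 hr1 r1 hr1).2
    nlinarith [mul_le_mul_of_nonneg_left k2 hσ, mul_le_mul_of_nonneg_left k3 hσ]
  exfalso
  push Not at hdown hup
  obtain ⟨r, hr, x, hx1, hx2, hx3⟩ := hdown
  obtain ⟨r', hr', x', hx1', hx2', hx3'⟩ := hup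
  have b1 := hm r hr
  have b2 := hm r' hr'
  have c1 := stepA r hr r' (by linarith) (by linarith)
  have c2 := stepA r' hr' r (by linarith) (by linarith)
  have c3 := stepA r hr x hx2 (by linarith)
  have c4 : 0 < g r - g x := by
    refine lt_of_le_of_lt ?_ hx3
    apply mul_nonneg hσ
    have : (r : ℝ) < x := by exact_mod_cast hx1
    linarith
  have c5 := hM (max (g r) (g r') - 2 * M) (min (g r) (g r') + 2 * M) (by
    intro l h1 h2
    have e1 := le_max_left (g r) (g r')
    have e2 := le_max_right (g r) (g r')
    have e3 := min_le_left (g r) (g r')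
    have e4 := min_le_right (g r) (g r')
    exact act_two hd (hatt r hr) (hw r hr).1 (hw r hr).2 b1.1 b1.2 (hatt r' hr') (hw r' hr').1
      (hw r' hr').2 b2.1 b2.2 hx1 hx2 hx1' hx2' (D := 2 * M) (by linarith) hx3.le hx3'.le
      (by linarith) (by linarith) (by linarith) (by linarith))
  rcases le_total (g r) (g r') with h | h
  · rw [max_eq_right h, min_eq_left h] at c5; linarith
  · rw [max_eq_left h, min_eq_right h] at c5; linarith

/-! ### Large essential peaks -/

lemma sum_len {p q : ℤ → ℤ} {lo : ℤ} (S : Finset ℤ) : ∀ hi : ℤ, lo ≤ hi →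
    (∀ r ∈ S, lo ≤ p r ∧ p r < r ∧ r < q r ∧ q r ≤ hi) →
    (∀ r ∈ S, ∀ r' ∈ S, r < r' → q r ≤ p r') →
    ∑ r ∈ S, (q r - p r) ≤ hi - lo := by
  induction S using Finset.induction_on_max with
  | empty => intro hi h _ _; simpa using h
  | insert a T ha ih =>
    intro hi h h1 h2
    have haT : a ∉ T := fun h => lt_irrefl _ (ha a h)
    have ma : a ∈ insert a T := Finset.mem_insert_self _ _
    have mm : ∀ r ∈ T, r ∈ insert a T := fun r hr => Finset.mem_insert_of_mem hr
    have hpa := h1 a ma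
    have := ih (p a) hpa.1 (fun r hr => by
      have := h1 r (mm r hr)
      exact ⟨this.1, this.2.1, this.2.2.1, h2 r (mm r hr) a ma (ha r hr)⟩)
      (fun r hr r' hr' => h2 r (mm r hr) r' (mm r' hr'))
    rw [Finset.sum_insert haT]
    linarith

lemma ess_pos {u g : ℤ → ℝ} {r w p q : ℤ} (ha : Att u g r w)
    (hp : p < r) (hq : r < q) (hgp : g p < g r) (hgq : g q < g r)
    (he : ∀ k, p < k → k < q → u k ≤ g r - (2 * g r - g p - g q) / 4) : 1 ≤ w := by
  have h0 := ha.1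
  by_contra hw
  have hw0 : w = 0 := by linarith
  subst hw0
  have h1 := ha.2
  have e : Finset.Ico (r - 0) (r + 0 + 1) = {r} := by
    ext x; simp only [Finset.mem_Ico, Finset.mem_singleton]; omega
  rw [e, Finset.sum_singleton] at h1
  have := he r hp hq
  push_cast at h1
  linarith

lemma ess_win {u g : ℤ → ℝ} (hd : Dom u g) {r w p q : ℤ} (ha : Att u g r w)
    (hp : p < r) (hq : r < q) (hgp : g p < g r) (hgq : g q < g r)
    (he : ∀ k, p < k → k < q → u k ≤ g r - (2 * g r - g p - g q) / 4) :
    (∃ y, r - w ≤ y ∧ y ≤ p ∧ g r ≤ u y) ∧ (∃ y, q ≤ y ∧ y ≤ r + w ∧ g r ≤ u y) := by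
  have h0 := ha.1
  have out : ∀ y, g r ≤ u y → y ≤ p ∨ q ≤ y := by
    intro y hy
    by_contra hc
    push Not at hc
    have := he y hc.1 hc.2
    linarith
  have hpr : (p : ℝ) < r := by exact_mod_cast hp
  have hqr : (r : ℝ) < q := by exact_mod_cast hq
  have hA : q ≤ r + w → ∃ y, r - w ≤ y ∧ y ≤ p ∧ g r ≤ u y := by
    intro hqw
    have hqw' : (q : ℝ) ≤ r + w := by exact_mod_cast hqw
    obtain ⟨y, hy1, hy2, hy3⟩ := win_Lp hd ha hq hqw (D := 0) (by
      rw [mul_zero]; apply mul_nonneg <;> linarith)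
    rw [add_zero] at hy3
    rcases out y hy3 with h | h
    · exact ⟨y, hy1, h, hy3⟩
    · linarith
  have hB : r ≤ p + w → ∃ y, q ≤ y ∧ y ≤ r + w ∧ g r ≤ u y := by
    intro hpw
    have hpw' : (r : ℝ) ≤ p + w := by exact_mod_cast hpw
    obtain ⟨y, hy1, hy2, hy3⟩ := win_Rm hd ha hp hpw (D := 0) (by
      rw [mul_zero]; apply mul_nonneg <;> linarith)
    rw [add_zero] at hy3
    rcases out y hy3 with h | h
    · linarith
    · exact ⟨y, h, by linarith, hy3⟩
  have hC : q ≤ r + w ∨ r ≤ p + w := by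
    by_contra hc
    push Not at hc
    have hcard : ((Finset.Ico (r - w) (r + w + 1)).card : ℝ) = 2 * w + 1 := by
      have : ((Finset.Ico (r - w) (r + w + 1)).card : ℤ) = 2 * w + 1 := by
        rw [Int.card_Ico_of_le _ _ (by linarith)]; ring
      exact_mod_cast this
    obtain ⟨y, hy, hy2⟩ := exists_ge_of_sum (u := u) (c := g r)
      (s := Finset.Ico (r - w) (r + w + 1)) (by rw [Finset.nonempty_Ico]; linarith)
      (by rw [ha.2, hcard])
    rw [Finset.mem_Ico] at hy
    rcases out y hy2 with h | h <;> linarith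
  rcases hC with h | h
  · obtain ⟨y, h1, h2, h3⟩ := hA h
    exact ⟨⟨y, h1, h2, h3⟩, hB (by linarith)⟩
  · obtain ⟨y, h1, h2, h3⟩ := hB h
    exact ⟨hA (by linarith), ⟨y, h1, h2, h3⟩⟩

lemma ess_act {u g : ℤ → ℝ} (hd : Dom u g) {N : ℕ} {m r w p q : ℤ} {l : ℝ} (ha : Att u g r w)
    (hp : p < r) (hq : r < q) (hgp : g p < g r) (hgq : g q < g r)
    (he : ∀ k, p < k → k < q → u k ≤ g r - (2 * g r - g p - g q) / 4)
    (hw1 : 2 ^ N ≤ w) (hw2 : w < 2 * 2 ^ N) (hm : m ≤ r)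
    (hm2 : r < m + 2 ^ N) (hl : w < 32 * (q - p))
    (h1 : g r - (2 * g r - g p - g q) / 4 < l) (h2 : l < g r) : Act u N m l := by
  obtain ⟨⟨y, y1, y2, y3⟩, ⟨z, z1, z2, z3⟩⟩ := ess_win hd ha hp hq hgp hgq he
  have e1 := he (p + 1) (by linarith) (by linarith)
  have e2 := he (q - 1) (by linarith) (by linarith)
  obtain ⟨c, hc1, hc2, hc3⟩ := exists_crs (u := u) (l := l) (x := y) (y := p + 1) (by linarith)
    (fun h => by linarith [h.1 (by linarith)])
  obtain ⟨c', hc1', hc2', hc3'⟩ := exists_crs (u := u) (l := l) (x := q - 1) (y := z) (by linarith)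
    (fun h => by linarith [h.2 (by linarith)])
  refine ⟨c, c', hc3, hc3', ?_, ?_, ?_⟩
  · omega
  · omega
  · omega

lemma large_cell {u g : ℤ → ℝ} (hd : Dom u g) (S : Finset ℤ) (p q w : ℤ → ℤ) (N : ℕ) (m : ℤ)
    (M : ℝ) (hatt : ∀ r ∈ S, Att u g r (w r))
    (hw : ∀ r ∈ S, 2 ^ N ≤ w r ∧ w r < 2 * 2 ^ N)
    (hm : ∀ r ∈ S, m ≤ r ∧ r < m + 2 ^ N)
    (hpk : ∀ r ∈ S, p r < r ∧ r < q r ∧ g (p r) < g r ∧ g (q r) < g r)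
    (hord : ∀ r ∈ S, ∀ r' ∈ S, r < r' → q r ≤ p r')
    (hlg : ∀ r ∈ S, w r < 32 * (q r - p r))
    (he : ∀ r ∈ S, ∀ k, p r < k → k < q r →
      u k ≤ g r - (2 * g r - g (p r) - g (q r)) / 4)
    (hM : ∀ α β, (∀ l, α < l → l < β → Act u N m l) → β - α ≤ M) :
    ∑ r ∈ S, (2 * g r - g (p r) - g (q r)) ≤ 640 * M := by
  have hM0 : 0 ≤ M := by
    have := hM 0 0 (fun l h1 h2 => absurd h1 (not_lt.2 h2.le))
    simpa using this
  have hN : (0 : ℤ) < 2 ^ N := by positivity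
  have hNr : (0 : ℝ) < 2 ^ N := by positivity
  have hlen : ∑ r ∈ S, (q r - p r) ≤ (m + 3 * 2 ^ N) - (m - 2 * 2 ^ N) := by
    apply sum_len S _ (by linarith) _ hord
    intro r hr
    obtain ⟨⟨y, y1, y2, y3⟩, ⟨z, z1, z2, z3⟩⟩ := ess_win hd (hatt r hr) (hpk r hr).1
      (hpk r hr).2.1 (hpk r hr).2.2.1 (hpk r hr).2.2.2 (he r hr)
    have a1 := hw r hr
    have a2 := hm r hr
    have a3 := hpk r hr
    exact ⟨by linarith, a3.1, a3.2.1, by linarith⟩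
  have hlenr : ∑ r ∈ S, ((q r : ℝ) - p r) ≤ 5 * 2 ^ N := by
    have : ∑ r ∈ S, (q r - p r) ≤ 5 * 2 ^ N := by linarith
    exact_mod_cast this
  have hone : ∀ r ∈ S, 2 * g r - g (p r) - g (q r) ≤ 128 * M / 2 ^ N * ((q r : ℝ) - p r) := by
    intro r hr
    have k := hM (g r - (2 * g r - g (p r) - g (q r)) / 4) (g r) (fun l h1 h2 =>
      ess_act hd (hatt r hr) (hpk r hr).1
      (hpk r hr).2.1 (hpk r hr).2.2.1 (hpk r hr).2.2.2 (he r hr) (hw r hr).1 (hw r hr).2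
      (hm r hr).1 (hm r hr).2 (hlg r hr) h1 h2)
    have k2 : (2 : ℝ) ^ N ≤ 32 * ((q r : ℝ) - p r) := by
      have : (2 : ℤ) ^ N ≤ 32 * (q r - p r) := by linarith [hlg r hr, (hw r hr).1]
      exact_mod_cast this
    have : 4 * M ≤ 128 * M / 2 ^ N * ((q r : ℝ) - p r) := by
      rw [div_mul_eq_mul_div, le_div_iff₀ hNr]
      nlinarith
    linarith
  calc _ ≤ ∑ r ∈ S, 128 * M / 2 ^ N * ((q r : ℝ) - p r) := Finset.sum_le_sum hone
    _ = 128 * M / 2 ^ N * ∑ r ∈ S, ((q r : ℝ) - p r) := by rw [Finset.mul_sum]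
    _ ≤ 128 * M / 2 ^ N * (5 * 2 ^ N) := by gcongr
    _ = 640 * M := by field_simp; ring

/-! ### Counting active keys -/

lemma sum_geo (J : Finset ℕ) (N0 : ℕ) (h : ∀ N ∈ J, N0 ≤ N) :
    ∑ N ∈ J, ((2 : ℝ) ^ N)⁻¹ ≤ 2 * ((2 : ℝ) ^ N0)⁻¹ := by
  have key : ∀ n, N0 ≤ n → ∑ N ∈ Finset.Ico N0 n, ((2 : ℝ) ^ N)⁻¹
      = 2 * ((2 : ℝ) ^ N0)⁻¹ - 2 * ((2 : ℝ) ^ n)⁻¹ := by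
    intro n hn
    induction n, hn using Nat.le_induction with
    | base => simp
    | succ n hn ih =>
      rw [Finset.sum_Ico_succ_top hn, ih, pow_succ, mul_inv]; ring
  have hsub : J ⊆ Finset.Ico N0 (max N0 (J.sup id + 1)) := by
    intro N hN
    rw [Finset.mem_Ico]
    have : N ≤ J.sup id := Finset.le_sup (f := id) hN
    exact ⟨h N hN, lt_max_of_lt_right (by omega)⟩
  refine (Finset.sum_le_sum_of_subset_of_nonneg hsub (fun _ _ _ => by positivity)).trans ?_
  rw [key _ (le_max_left _ _)]
  have : 0 < 2 * ((2 : ℝ) ^ (max N0 (J.sup id + 1)))⁻¹ := by positivity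
  linarith

lemma sum_geo' (J : Finset ℕ) {γ : ℝ} (hγ : 0 < γ) (h : ∀ N ∈ J, γ ≤ 8 * 2 ^ N) :
    ∑ N ∈ J, ((2 : ℝ) ^ N)⁻¹ ≤ 16 / γ := by
  rcases J.eq_empty_or_nonempty with hJ | hJ
  · subst hJ; simp; positivity
  · refine (sum_geo J (J.min' hJ) (fun N hN => J.min'_le N hN)).trans ?_
    have := h _ (J.min'_mem hJ)
    rw [le_div_iff₀ hγ]
    have hp : (0 : ℝ) < 2 ^ (J.min' hJ) := by positivity
    calc 2 * ((2 : ℝ) ^ (J.min' hJ))⁻¹ * γ ≤ 2 * ((2 : ℝ) ^ (J.min' hJ))⁻¹ * (8 * 2 ^ (J.min' hJ)) := by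
          gcongr
      _ = 16 := by field_simp; ring

/-- Sum over keys attached to one gap. -/
lemma sum_keys (T : Finset (ℕ × ℤ)) (d : ℤ) {γ : ℝ} (hγ : 0 < γ)
    (h : ∀ t ∈ T, γ ≤ 8 * 2 ^ t.1 ∧ t.2 * 2 ^ (t.1 - 4) - 4 * 2 ^ t.1 ≤ d ∧
      d ≤ t.2 * 2 ^ (t.1 - 4) + 4 * 2 ^ t.1) :
    ∑ t ∈ T, ((2 : ℝ) ^ t.1)⁻¹ ≤ 129 * (16 / γ) := by
  rw [← Finset.sum_fiberwise_of_maps_to (s := T) (t := T.image Prod.fst) (g := Prod.fst)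
    (fun t ht => Finset.mem_image_of_mem _ ht)]
  have h1 : ∀ N ∈ T.image Prod.fst, ∑ t ∈ T with t.1 = N, ((2 : ℝ) ^ t.1)⁻¹
      ≤ 129 * ((2 : ℝ) ^ N)⁻¹ := by
    intro N hN
    have e : ∑ t ∈ T with t.1 = N, ((2 : ℝ) ^ t.1)⁻¹ = ∑ t ∈ T with t.1 = N, ((2 : ℝ) ^ N)⁻¹ := by
      apply Finset.sum_congr rfl
      intro t ht
      rw [(Finset.mem_filter.1 ht).2]
    rw [e, Finset.sum_const, nsmul_eq_mul]
    have hc : (T.filter (fun t => t.1 = N)).card ≤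
        (Finset.Ico (d / 2 ^ (N - 4) - 64) (d / 2 ^ (N - 4) + 65)).card := by
      apply Finset.card_le_card_of_injOn Prod.snd
      · intro t ht
        have ht' := Finset.mem_filter.1 ht
        have a := (h t ht'.1).2
        rw [ht'.2] at a
        have hh : (0 : ℤ) < 2 ^ (N - 4) := by positivity
        have h16 : (2 : ℤ) ^ N ≤ 16 * 2 ^ (N - 4) := by
          have : (2 : ℤ) ^ N ≤ 2 ^ (4 + (N - 4)) := by
            apply pow_le_pow_right₀ (by norm_num); omega
          rw [pow_add] at this
          linarith
        have b1 := Int.mul_ediv_add_emod d (2 ^ (N - 4))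
        have b2 := Int.emod_nonneg d hh.ne'
        have b3 := Int.emod_lt_of_pos d hh
        rw [Finset.mem_coe, Finset.mem_Ico]
        constructor
        · by_contra hc
          push Not at hc
          nlinarith
        · by_contra hc
          push Not at hc
          nlinarith
      · intro t ht t' ht' htt
        have a1 := (Finset.mem_filter.1 ht).2
        have a2 := (Finset.mem_filter.1 ht').2
        exact Prod.ext (a1.trans a2.symm) htt
    have hc2 : (Finset.Ico (d / 2 ^ (N - 4) - 64) (d / 2 ^ (N - 4) + 65)).card = 129 := by
      rw [Int.card_Ico]; omega
    rw [hc2] at hc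
    have hc3 : ((T.filter (fun t => t.1 = N)).card : ℝ) ≤ 129 := by exact_mod_cast hc
    gcongr
  refine (Finset.sum_le_sum h1).trans ?_
  rw [← Finset.mul_sum]
  gcongr
  apply sum_geo' _ hγ
  intro N hN
  obtain ⟨t, ht, rfl⟩ := Finset.mem_image.1 hN
  exact (h t ht).1

open Classical in
/-- Next element of `X` after `c`, or `c` itself. -/
def nxt (X : Finset ℤ) (c : ℤ) : ℤ :=
  if h : (X.filter (fun d => c < d)).Nonempty then (X.filter (fun d => c < d)).min' h else c

lemma nxt_lt {X : Finset ℤ} {c e : ℤ} (he : e ∈ X) (h : c < e) : c < nxt X c ∧ nxt X c ≤ e ∧ nxt X c ∈ X := by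
  have hm : e ∈ X.filter (fun d => c < d) := Finset.mem_filter.2 ⟨he, h⟩
  have hn : (X.filter (fun d => c < d)).Nonempty := ⟨e, hm⟩
  unfold nxt
  rw [dif_pos hn]
  have := Finset.mem_filter.1 (Finset.min'_mem _ hn)
  exact ⟨this.2, Finset.min'_le _ _ hm, this.1⟩

lemma gap_sum {X : Finset ℤ} {c c' : ℤ} (hc : c ∈ X) (hc' : c' ∈ X) :
    c' - c ≤ ∑ d ∈ X with (c ≤ d ∧ d < c'), (nxt X d - d) := by
  have hsub : Finset.Ico c c' ⊆ (X.filter (fun d => c ≤ d ∧ d < c')).biUnion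
      (fun d => Finset.Ico d (nxt X d)) := by
    intro x hx
    rw [Finset.mem_Ico] at hx
    have hn : (X.filter (fun d => d ≤ x)).Nonempty := ⟨c, Finset.mem_filter.2 ⟨hc, hx.1⟩⟩
    set d := (X.filter (fun d => d ≤ x)).max' hn with hd
    have h1 := Finset.mem_filter.1 (Finset.max'_mem _ hn)
    rw [← hd] at h1
    have h2 : c ≤ d := Finset.le_max' _ _ (Finset.mem_filter.2 ⟨hc, hx.1⟩)
    have h3 : d < c' := by linarith
    have h4 := nxt_lt hc' h3
    rw [Finset.mem_biUnion]
    refine ⟨d, Finset.mem_filter.2 ⟨h1.1, h2, h3⟩, ?_⟩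
    rw [Finset.mem_Ico]
    refine ⟨h1.2, ?_⟩
    by_contra hcon
    push Not at hcon
    have h5 : nxt X d ∈ X.filter (fun d => d ≤ x) := Finset.mem_filter.2 ⟨h4.2.2, hcon⟩
    have h6 : nxt X d ≤ d := Finset.le_max' _ _ h5
    linarith
  have h1 := (Finset.card_le_card hsub).trans Finset.card_biUnion_le
  rw [Int.card_Ico] at h1
  have h2 : ((c' - c).toNat : ℤ) ≤ ∑ d ∈ X with (c ≤ d ∧ d < c'), ((Finset.Ico d (nxt X d)).card : ℤ) := by
    exact_mod_cast h1
  have h3 : ∑ d ∈ X with (c ≤ d ∧ d < c'), ((Finset.Ico d (nxt X d)).card : ℤ)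
      = ∑ d ∈ X with (c ≤ d ∧ d < c'), (nxt X d - d) := by
    apply Finset.sum_congr rfl
    intro d hd
    have := nxt_lt hc' (Finset.mem_filter.1 hd).2.2
    rw [Int.card_Ico_of_le _ _ this.1.le]
  have := Int.self_le_toNat (c' - c)
  linarith

open Classical in
lemma count_keys {u : ℤ → ℝ} {l : ℝ} (T : Finset (ℕ × ℤ)) (X : Finset ℤ)
    (hact : ∀ t ∈ T, Act u t.1 (t.2 * 2 ^ (t.1 - 4)) l)
    (hX : ∀ t ∈ T, ∀ c, Crs u l c → t.2 * 2 ^ (t.1 - 4) - 4 * 2 ^ t.1 ≤ c →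
      c ≤ t.2 * 2 ^ (t.1 - 4) + 4 * 2 ^ t.1 → c ∈ X) :
    (T.card : ℝ) ≤ 132096 * X.card := by
  -- the relation between keys and gaps
  let R : (ℕ × ℤ) → ℤ → Prop := fun t d => 0 < ((nxt X d : ℝ) - d) ∧
    ((nxt X d : ℝ) - d) ≤ 8 * 2 ^ t.1 ∧ t.2 * 2 ^ (t.1 - 4) - 4 * 2 ^ t.1 ≤ d ∧
      d ≤ t.2 * 2 ^ (t.1 - 4) + 4 * 2 ^ t.1
  have h1 : ∀ t ∈ T, (1 : ℝ) ≤ ∑ d ∈ X with R t d, 64 * ((nxt X d : ℝ) - d) * ((2 : ℝ) ^ t.1)⁻¹ := by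
    intro t ht
    obtain ⟨c, c', hc, hc', hlen, hl, hr⟩ := hact t ht
    have hN : (0 : ℤ) < 2 ^ t.1 := by positivity
    have hNr : (0 : ℝ) < 2 ^ t.1 := by positivity
    have mc := hX t ht c hc hl (by linarith)
    have mc' := hX t ht c' hc' (by linarith) hr
    have hg := gap_sum mc mc'
    have hsub : X.filter (fun d => c ≤ d ∧ d < c') ⊆ X.filter (fun d => R t d) := by
      intro d hd
      have hd' := Finset.mem_filter.1 hd
      have hn := nxt_lt mc' hd'.2.2
      refine Finset.mem_filter.2 ⟨hd'.1, ?_, ?_, ?_, ?_⟩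
      · have : 0 < nxt X d - d := by linarith
        exact_mod_cast this
      · have : nxt X d - d ≤ 8 * 2 ^ t.1 := by linarith
        exact_mod_cast this
      · linarith
      · linarith
    have hs : ∑ d ∈ X with (c ≤ d ∧ d < c'), ((nxt X d : ℝ) - d) ≤
        ∑ d ∈ X with R t d, ((nxt X d : ℝ) - d) := by
      apply Finset.sum_le_sum_of_subset_of_nonneg hsub
      intro d hd _
      exact (Finset.mem_filter.1 hd).2.1.le
    have hgr : (c' : ℝ) - c ≤ ∑ d ∈ X with (c ≤ d ∧ d < c'), ((nxt X d : ℝ) - d) := by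
      exact_mod_cast hg
    have hlr : (2 : ℝ) ^ t.1 ≤ 64 * ((c' : ℝ) - c) := by exact_mod_cast hlen
    have e : ∑ d ∈ X with R t d, 64 * ((nxt X d : ℝ) - d) * ((2 : ℝ) ^ t.1)⁻¹
        = (64 * ∑ d ∈ X with R t d, ((nxt X d : ℝ) - d)) / 2 ^ t.1 := by
      rw [Finset.mul_sum, Finset.sum_div]
      rfl
    rw [e, le_div_iff₀ hNr]
    linarith
  calc (T.card : ℝ) = ∑ t ∈ T, (1 : ℝ) := by simp
    _ ≤ ∑ t ∈ T, ∑ d ∈ X with R t d, 64 * ((nxt X d : ℝ) - d) * ((2 : ℝ) ^ t.1)⁻¹ :=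
        Finset.sum_le_sum h1
    _ = ∑ d ∈ X, ∑ t ∈ T with R t d, 64 * ((nxt X d : ℝ) - d) * ((2 : ℝ) ^ t.1)⁻¹ := by
        simp_rw [Finset.sum_filter]
        rw [Finset.sum_comm]
    _ ≤ ∑ d ∈ X, (132096 : ℝ) := by
        apply Finset.sum_le_sum
        intro d hd
        by_cases hp : 0 < ((nxt X d : ℝ) - d)
        · rw [← Finset.mul_sum]
          have := sum_keys (T.filter (fun t => R t d)) d hp
            (fun t ht => (Finset.mem_filter.1 ht).2.2)
          calc _ ≤ 64 * ((nxt X d : ℝ) - d) * (129 * (16 / ((nxt X d : ℝ) - d))) := by gcongr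
            _ = 132096 := by field_simp; norm_num
        · rw [Finset.filter_false_of_mem (fun t _ h => hp h.1)]
          simp
    _ = 132096 * X.card := by rw [Finset.sum_const, nsmul_eq_mul, mul_comm]

/-! ### Integration over levels -/

open MeasureTheory in
open Classical in
lemma integ_keys {u : ℤ → ℝ} (T : Finset (ℕ × ℤ)) (α β : ℕ × ℤ → ℝ) {V : ℝ}
    (hab : ∀ t ∈ T, α t ≤ β t)
    (hact : ∀ t ∈ T, ∀ l, α t < l → l < β t → Act u t.1 (t.2 * 2 ^ (t.1 - 4)) l)
    (hV : ∀ s : Finset ℤ, ∑ c ∈ s, |u (c + 1) - u c| ≤ V) :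
    ∑ t ∈ T, (β t - α t) ≤ 132096 * V := by
  have hV0 : 0 ≤ V := by simpa using hV ∅
  let W : Finset ℤ := T.biUnion (fun t => Finset.Icc (t.2 * 2 ^ (t.1 - 4) - 4 * 2 ^ t.1)
    (t.2 * 2 ^ (t.1 - 4) + 4 * 2 ^ t.1))
  have hpt : ∀ l : ℝ, ∑ t ∈ T, (Set.Ioo (α t) (β t)).indicator (1 : ℝ → ENNReal) l ≤
      132096 * ∑ c ∈ W, (Set.Ico (min (u c) (u (c + 1))) (max (u c) (u (c + 1)))).indicator
        (1 : ℝ → ENNReal) l := by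
    intro l
    have h1 : ∑ t ∈ T, (Set.Ioo (α t) (β t)).indicator (1 : ℝ → ENNReal) l
        = ((T.filter (fun t => l ∈ Set.Ioo (α t) (β t))).card : ENNReal) := by
      rw [Finset.card_filter]
      push_cast
      apply Finset.sum_congr rfl
      intro t _
      simp [Set.indicator_apply]
    have h2 : ∑ c ∈ W, (Set.Ico (min (u c) (u (c + 1))) (max (u c) (u (c + 1)))).indicator
        (1 : ℝ → ENNReal) l = ((W.filter (fun c => Crs u l c)).card : ENNReal) := by
      rw [Finset.card_filter]
      push_cast
      apply Finset.sum_congr rfl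
      intro c _
      have : l ∈ Set.Ico (min (u c) (u (c + 1))) (max (u c) (u (c + 1))) ↔ Crs u l c := by
        unfold Crs
        rw [Set.mem_Ico, min_le_iff, lt_max_iff]
        constructor
        · rintro ⟨h1, h2⟩ h3
          rcases h2 with h2 | h2
          · rcases h1 with h1 | h1 <;> linarith [h3.1 h2]
          · rcases h1 with h1 | h1 <;> linarith [h3.2 h2]
        · intro h
          by_cases h1 : l < u c
          · by_cases h2 : l < u (c + 1)
            · exact absurd ⟨fun _ => h2, fun _ => h1⟩ h
            · exact ⟨Or.inr (not_lt.1 h2), Or.inl h1⟩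
          · by_cases h2 : l < u (c + 1)
            · exact ⟨Or.inl (not_lt.1 h1), Or.inr h2⟩
            · exact absurd ⟨fun h => absurd h h1, fun h => absurd h h2⟩ h
      simp [Set.indicator_apply, this]
    rw [h1, h2]
    have h3 := count_keys (u := u) (l := l) (T.filter (fun t => l ∈ Set.Ioo (α t) (β t)))
      (W.filter (fun c => Crs u l c)) (by
        intro t ht
        have ht' := Finset.mem_filter.1 ht
        exact hact t ht'.1 l ht'.2.1 ht'.2.2) (by
        intro t ht c hc h1 h2
        have ht' := Finset.mem_filter.1 ht
        refine Finset.mem_filter.2 ⟨?_, hc⟩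
        exact Finset.mem_biUnion.2 ⟨t, ht'.1, Finset.mem_Icc.2 ⟨h1, h2⟩⟩)
    exact_mod_cast h3
  have hmono := lintegral_mono (μ := volume) hpt
  rw [lintegral_finsetSum _ (fun t _ => measurable_one.indicator measurableSet_Ioo),
    lintegral_const_mul _ (Finset.measurable_sum _ (fun c _ => measurable_one.indicator measurableSet_Ico)),
    lintegral_finsetSum _ (fun c _ => measurable_one.indicator measurableSet_Ico)] at hmono
  simp only [lintegral_indicator_one measurableSet_Ioo, lintegral_indicator_one measurableSet_Ico,
    Real.volume_Ioo, Real.volume_Ico, max_sub_min_eq_abs] at hmono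
  rw [← ENNReal.ofReal_sum_of_nonneg (fun t ht => sub_nonneg.2 (hab t ht)),
    ← ENNReal.ofReal_sum_of_nonneg (fun c _ => abs_nonneg _)] at hmono
  have e : (132096 : ENNReal) = ENNReal.ofReal 132096 := by simp
  rw [e, ← ENNReal.ofReal_mul (by norm_num)] at hmono
  have hnn : (0 : ℝ) ≤ 132096 * ∑ c ∈ W, |u (c + 1) - u c| :=
    mul_nonneg (by norm_num) (Finset.sum_nonneg (fun _ _ => abs_nonneg _))
  have := (ENNReal.ofReal_le_ofReal_iff hnn).1 hmono
  linarith [hV W]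

/-! ### Sum over all peaks -/

lemma sub_le_sum_abs (u : ℤ → ℝ) {x y : ℤ} (hxy : x ≤ y) :
    |u y - u x| ≤ ∑ c ∈ Finset.Ico x y, |u (c + 1) - u c| := by
  induction y, hxy using Int.leInduction with
  | base => simp
  | succ n hn ih =>
    have e : Finset.Ico x (n + 1) = insert n (Finset.Ico x n) := by
      ext k; simp only [Finset.mem_Ico, Finset.mem_insert]; omega
    rw [e, Finset.sum_insert (by simp)]
    have : u (n + 1) - u x = (u (n + 1) - u n) + (u n - u x) := by ring
    rw [this]
    exact (abs_add_le _ _).trans (by linarith)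

lemma noness_sum {u g : ℤ → ℝ} (hd : Dom u g) (S : Finset ℤ) (p q : ℤ → ℤ) {V : ℝ}
    (hpk : ∀ r ∈ S, p r < r ∧ r < q r ∧ g (p r) < g r ∧ g (q r) < g r)
    (hord : ∀ r ∈ S, ∀ r' ∈ S, r < r' → q r ≤ p r')
    (hne : ∀ r ∈ S, ¬ ∀ k, p r < k → k < q r → u k ≤ g r - (2 * g r - g (p r) - g (q r)) / 4)
    (hV : ∀ s : Finset ℤ, ∑ c ∈ s, |u (c + 1) - u c| ≤ V) :
    ∑ r ∈ S, (2 * g r - g (p r) - g (q r)) ≤ 2 * V := by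
  have h1 : ∀ r ∈ S, 2 * g r - g (p r) - g (q r) ≤
      2 * ∑ c ∈ Finset.Ico (p r) (q r), |u (c + 1) - u c| := by
    intro r hr
    have h := hne r hr
    push Not at h
    obtain ⟨k, hk1, hk2, hk3⟩ := h
    have a1 := sub_le_sum_abs u hk1.le
    have a2 := sub_le_sum_abs u hk2.le
    have a3 := sum_Ico_split (fun c => |u (c + 1) - u c|) hk1.le hk2.le
    have b1 := le_abs_self (u k - u (p r))
    have b2 := neg_abs_le (u (q r) - u k)
    have c1 := hd.le (p r)
    have c2 := hd.le (q r)
    linarith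
  refine (Finset.sum_le_sum h1).trans ?_
  rw [← Finset.mul_sum, ← Finset.sum_biUnion]
  · linarith [hV (S.biUnion (fun r => Finset.Ico (p r) (q r)))]
  · intro r hr r' hr' hne
    rw [Function.onFun, Finset.disjoint_left]
    intro x hx hx'
    rw [Finset.mem_Ico] at hx hx'
    rcases lt_or_gt_of_ne hne with h | h
    · have := hord r hr r' hr' h; linarith
    · have := hord r' hr' r hr h; linarith

/-- The key of a peak with center `r` and radius `w`. -/
def key (r w : ℤ) : ℕ × ℤ := (Nat.log 2 w.toNat, r / 2 ^ (Nat.log 2 w.toNat - 4))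

lemma key_w {r w : ℤ} {t : ℕ × ℤ} (hw : 1 ≤ w) (ht : key r w = t) :
    (2 : ℤ) ^ t.1 ≤ w ∧ w < 2 * 2 ^ t.1 := by
  subst ht
  have h0 : w.toNat ≠ 0 := by omega
  have h1 := Nat.pow_log_le_self 2 h0
  have h2 := Nat.lt_pow_succ_log_self (b := 2) (by norm_num) w.toNat
  have e : (w.toNat : ℤ) = w := Int.toNat_of_nonneg (by linarith)
  have h1' : (2 : ℤ) ^ (Nat.log 2 w.toNat) ≤ (w.toNat : ℤ) := by exact_mod_cast h1
  have h2' : (w.toNat : ℤ) < (2 : ℤ) ^ (Nat.log 2 w.toNat + 1) := by exact_mod_cast h2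
  rw [e] at h1' h2'
  rw [pow_succ] at h2'
  simp only [key]
  exact ⟨h1', by linarith⟩

lemma key_m {r w : ℤ} {t : ℕ × ℤ} (ht : key r w = t) :
    t.2 * 2 ^ (t.1 - 4) ≤ r ∧ r < t.2 * 2 ^ (t.1 - 4) + 2 ^ (t.1 - 4) := by
  subst ht
  simp only [key]
  have hh : (0 : ℤ) < 2 ^ (Nat.log 2 w.toNat - 4) := by positivity
  have b1 := Int.mul_ediv_add_emod r (2 ^ (Nat.log 2 w.toNat - 4))
  have b2 := Int.emod_nonneg r hh.ne'
  have b3 := Int.emod_lt_of_pos r hh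
  constructor <;> linarith

open Classical in
lemma peaks_sum {u g : ℤ → ℝ} (hd : Dom u g) (S : Finset ℤ) (p q w : ℤ → ℤ) {V : ℝ}
    (hatt : ∀ r ∈ S, Att u g r (w r))
    (hpk : ∀ r ∈ S, p r < r ∧ r < q r ∧ g (p r) < g r ∧ g (q r) < g r)
    (hord : ∀ r ∈ S, ∀ r' ∈ S, r < r' → q r ≤ p r')
    (hV : ∀ s : Finset ℤ, ∑ c ∈ s, |u (c + 1) - u c| ≤ V) :
    ∑ r ∈ S, (2 * g r - g (p r) - g (q r)) ≤ (2 + 1286 * 132096) * V := by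
  let var : ℤ → ℝ := fun r => 2 * g r - g (p r) - g (q r)
  let Sm : ℤ → Prop := fun r => 32 * (q r - p r) ≤ w r
  let Es : ℤ → Prop := fun r => ∀ k, p r < k → k < q r →
    u k ≤ g r - (2 * g r - g (p r) - g (q r)) / 4
  let G : Finset ℤ := S.filter (fun r => Sm r ∨ Es r)
  let κ : ℤ → ℕ × ℤ := fun r => key r (w r)
  have hw1 : ∀ r ∈ G, 1 ≤ w r := by
    intro r hr
    obtain ⟨hrS, h⟩ := Finset.mem_filter.1 hr
    have a := hpk r hrS
    rcases h with h | h
    · have h' : 32 * (q r - p r) ≤ w r := h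
      linarith
    · exact ess_pos (hatt r hrS) a.1 a.2.1 a.2.2.1 a.2.2.2 h
  -- the nonessential part
  have hno : ∑ r ∈ S with ¬ (Sm r ∨ Es r), var r ≤ 2 * V := by
    apply noness_sum hd _ p q (fun r hr => hpk r (Finset.mem_filter.1 hr).1)
      (fun r hr r' hr' => hord r (Finset.mem_filter.1 hr).1 r' (Finset.mem_filter.1 hr').1) _ hV
    intro r hr h
    exact (Finset.mem_filter.1 hr).2 (Or.inr h)
  -- each key has a long active interval
  have hkey : ∀ t : ℕ × ℤ, ∃ α β : ℝ, α ≤ β ∧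
      (∀ l, α < l → l < β → Act u t.1 (t.2 * 2 ^ (t.1 - 4)) l) ∧
      ∑ r ∈ G with κ r = t, var r ≤ 1286 * (β - α) := by
    intro t
    set Y := ∑ r ∈ G with κ r = t, var r with hY
    by_cases hY0 : Y ≤ 0
    · exact ⟨0, 0, le_rfl, fun l h1 h2 => absurd h1 (not_lt.2 h2.le), by simpa using hY0⟩
    push Not at hY0
    by_contra hcon
    push Not at hcon
    have hM : ∀ α β, (∀ l, α < l → l < β → Act u t.1 (t.2 * 2 ^ (t.1 - 4)) l) →
        β - α ≤ Y / 1286 := by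
      intro α β h
      rcases le_total α β with hab | hab
      · have := hcon α β hab h
        rw [le_div_iff₀ (by norm_num)]
        linarith
      · have : 0 ≤ Y / 1286 := by positivity
        linarith
    let G1 := (G.filter (fun r => κ r = t)).filter (fun r => Sm r)
    let G2 := (G.filter (fun r => κ r = t)).filter (fun r => ¬ Sm r)
    have hsplit : ∑ r ∈ G1, var r + ∑ r ∈ G2, var r = Y :=
      Finset.sum_filter_add_sum_filter_not _ _ _
    have mem1 : ∀ r ∈ G1, r ∈ G ∧ r ∈ S ∧ κ r = t ∧ Sm r := by
      intro r hr
      obtain ⟨h1, h2⟩ := Finset.mem_filter.1 hr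
      obtain ⟨h3, h4⟩ := Finset.mem_filter.1 h1
      exact ⟨h3, (Finset.mem_filter.1 h3).1, h4, h2⟩
    have mem2 : ∀ r ∈ G2, r ∈ G ∧ r ∈ S ∧ κ r = t ∧ ¬ Sm r ∧ Es r := by
      intro r hr
      obtain ⟨h1, h2⟩ := Finset.mem_filter.1 hr
      obtain ⟨h3, h4⟩ := Finset.mem_filter.1 h1
      exact ⟨h3, (Finset.mem_filter.1 h3).1, h4, h2, (Finset.mem_filter.1 h3).2.resolve_left h2⟩
    have k1 : ∑ r ∈ G1, var r ≤ 3 * (Y / 1286) := by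
      apply small_cell hd G1 p q w t.1 (t.2 * 2 ^ (t.1 - 4)) (Y / 1286)
        (fun r hr => hatt r (mem1 r hr).2.1)
        (fun r hr => key_w (hw1 r (mem1 r hr).1) (mem1 r hr).2.2.1) _
        (fun r hr => hpk r (mem1 r hr).2.1)
        (fun r hr r' hr' => hord r (mem1 r hr).2.1 r' (mem1 r' hr').2.1)
        (fun r hr => (mem1 r hr).2.2.2) hM
      intro r hr
      obtain ⟨hG, hS, hk, hs⟩ := mem1 r hr
      have hs' : 32 * (q r - p r) ≤ w r := hs
      have a := key_w (hw1 r hG) hk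
      have b := key_m hk
      have c := hpk r hS
      have hN : 4 ≤ t.1 := by
        by_contra hN
        have : (2 : ℤ) ^ t.1 ≤ 2 ^ 4 := pow_le_pow_right₀ (by norm_num) (by omega)
        linarith
      have e : (2 : ℤ) ^ t.1 = 16 * 2 ^ (t.1 - 4) := by
        have : t.1 = 4 + (t.1 - 4) := by omega
        conv_lhs => rw [this, pow_add]
        norm_num
      exact ⟨b.1, by linarith⟩
    have k2 : ∑ r ∈ G2, var r ≤ 640 * (Y / 1286) := by
      apply large_cell hd G2 p q w t.1 (t.2 * 2 ^ (t.1 - 4)) (Y / 1286)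
        (fun r hr => hatt r (mem2 r hr).2.1)
        (fun r hr => key_w (hw1 r (mem2 r hr).1) (mem2 r hr).2.2.1) _
        (fun r hr => hpk r (mem2 r hr).2.1)
        (fun r hr r' hr' => hord r (mem2 r hr).2.1 r' (mem2 r' hr').2.1)
        (fun r hr => not_le.1 (mem2 r hr).2.2.2.1)
        (fun r hr => (mem2 r hr).2.2.2.2) hM
      intro r hr
      have b := key_m (mem2 r hr).2.2.1
      have : (2 : ℤ) ^ (t.1 - 4) ≤ 2 ^ t.1 := pow_le_pow_right₀ (by norm_num) (by omega)
      exact ⟨b.1, by linarith⟩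
    have : 3 * (Y / 1286) + 640 * (Y / 1286) = Y / 2 := by ring
    linarith
  choose α β hab hact hYle using hkey
  have hes : ∑ r ∈ G, var r ≤ 1286 * (132096 * V) := by
    rw [← Finset.sum_fiberwise_of_maps_to (s := G) (t := G.image κ) (g := κ)
      (fun r hr => Finset.mem_image_of_mem _ hr)]
    refine (Finset.sum_le_sum (fun t _ => hYle t)).trans ?_
    rw [← Finset.mul_sum]
    have := integ_keys (u := u) (G.image κ) α β (V := V) (fun t _ => hab t)
      (fun t _ => hact t) hV
    linarith
  have hfin : ∑ r ∈ G, var r + ∑ r ∈ S with ¬ (Sm r ∨ Es r), var r = ∑ r ∈ S, var r :=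
    Finset.sum_filter_add_sum_filter_not _ _ _
  have : ∑ r ∈ S, (2 * g r - g (p r) - g (q r)) = ∑ r ∈ S, var r := rfl
  rw [this]
  linarith

/-! ### Extraction of peaks -/

lemma peaks_exist (g : ℤ → ℝ) (A B : ℤ) (hAB : A ≤ B) :
    ∃ (S : Finset ℤ) (p q : ℤ → ℤ) (s s1 : ℤ),
      (∀ r ∈ S, p r < r ∧ r < q r ∧ g (p r) < g r ∧ g (q r) < g r) ∧
      (∀ r ∈ S, ∀ r' ∈ S, r < r' → q r ≤ p r') ∧
      s ≤ B ∧ g s ≤ g B ∧ (∀ r ∈ S, q r ≤ s) ∧ (S.Nonempty → ∃ r ∈ S, q r = s) ∧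
      (S = ∅ → s1 = s) ∧
      ∑ k ∈ Finset.Ico A B, |g (k + 1) - g k| ≤
        (g A - g s1) + ∑ r ∈ S, (2 * g r - g (p r) - g (q r)) + (g B - g s) := by
  induction B, hAB using Int.leInduction with
  | base =>
    refine ⟨∅, id, id, A, A, ?_⟩
    simp
  | succ B hB ih =>
    obtain ⟨S, p, q, s, s1, hpk, hord, hsB, hgs, hqs, hlast, hs1, hsum⟩ := ih
    have e : Finset.Ico A (B + 1) = insert B (Finset.Ico A B) := by
      ext k; simp only [Finset.mem_Ico, Finset.mem_insert]; omega
    rw [e, Finset.sum_insert (by simp)]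
    by_cases h1 : g B ≤ g (B + 1)
    · refine ⟨S, p, q, s, s1, hpk, hord, by linarith, by linarith, hqs, hlast, hs1, ?_⟩
      rw [abs_of_nonneg (by linarith)]
      linarith
    push Not at h1
    rw [abs_of_nonpos (by linarith)]
    by_cases h2 : g s < g B
    · have hsB' : s < B := lt_of_le_of_ne hsB (fun h => by rw [h] at h2; exact lt_irrefl _ h2)
      have hlt : ∀ r ∈ S, r < B := fun r hr => by linarith [hqs r hr, (hpk r hr).2.1]
      have hBS : B ∉ S := fun h => lt_irrefl _ (hlt B h)
      have hp' : ∀ r ∈ S, Function.update p B s r = p r := fun r hr =>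
        Function.update_of_ne (hlt r hr).ne _ _
      have hq' : ∀ r ∈ S, Function.update q B (B + 1) r = q r := fun r hr =>
        Function.update_of_ne (hlt r hr).ne _ _
      refine ⟨insert B S, Function.update p B s, Function.update q B (B + 1), B + 1, s1,
        ?_, ?_, le_rfl, le_rfl, ?_, ?_, ?_, ?_⟩
      · intro r hr
        rcases Finset.mem_insert.1 hr with h | h
        · subst h
          simp only [Function.update_self]
          exact ⟨hsB', by linarith, h2, h1⟩
        · rw [hp' r h, hq' r h]; exact hpk r h
      · intro r hr r' hr' hrr
        rcases Finset.mem_insert.1 hr with h | h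
        · subst h
          rcases Finset.mem_insert.1 hr' with h' | h'
          · linarith
          · linarith [hlt r' h']
        · rw [hq' r h]
          rcases Finset.mem_insert.1 hr' with h' | h'
          · subst h'
            rw [Function.update_self]; exact hqs r h
          · rw [hp' r' h']; exact hord r h r' h' hrr
      · intro r hr
        rcases Finset.mem_insert.1 hr with h | h
        · subst h; rw [Function.update_self]
        · rw [hq' r h]; linarith [hqs r h]
      · intro _
        exact ⟨B, Finset.mem_insert_self _ _, by rw [Function.update_self]⟩
      · intro h; simp at h
      · rw [Finset.sum_insert hBS]
        simp only [Function.update_self]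
        have : ∑ r ∈ S, (2 * g r - g (Function.update p B s r) - g (Function.update q B (B + 1) r))
            = ∑ r ∈ S, (2 * g r - g (p r) - g (q r)) := by
          apply Finset.sum_congr rfl
          intro r hr
          rw [hp' r hr, hq' r hr]
        rw [this]
        linarith
    · have h3 : g s = g B := le_antisymm hgs (not_lt.1 h2)
      rcases S.eq_empty_or_nonempty with hS | hS
      · subst hS
        refine ⟨∅, p, q, B + 1, B + 1, by simp, by simp, le_rfl, le_rfl, by simp, by simp,
          by simp, ?_⟩
        have := hs1 rfl
        subst this
        simp only [Finset.sum_empty] at hsum ⊢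
        linarith
      · obtain ⟨a, haS, hqa⟩ := hlast hS
        have hlt : ∀ r ∈ S, r ≤ a := by
          intro r hr
          by_contra hc
          push Not at hc
          have := hord a haS r hr hc
          linarith [hpk r hr, hqs r hr, (hpk r hr).1, (hpk r hr).2.1]
        have hq' : ∀ r, r ≠ a → Function.update q a (B + 1) r = q r := fun r hr =>
          Function.update_of_ne hr _ _
        have hpa := hpk a haS
        rw [hqa] at hpa
        refine ⟨S, p, Function.update q a (B + 1), B + 1, s1, ?_, ?_, le_rfl, le_rfl, ?_, ?_, ?_, ?_⟩
        · intro r hr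
          by_cases h : r = a
          · subst h
            rw [Function.update_self]
            exact ⟨hpa.1, by linarith, hpa.2.2.1, by linarith⟩
          · rw [hq' r h]; exact hpk r hr
        · intro r hr r' hr' hrr
          have : r ≠ a := by
            intro h; subst h; linarith [hlt r' hr']
          rw [hq' r this]; exact hord r hr r' hr' hrr
        · intro r hr
          by_cases h : r = a
          · subst h; rw [Function.update_self]
          · rw [hq' r h]; linarith [hqs r hr]
        · intro _
          exact ⟨a, haS, by rw [Function.update_self]⟩
        · intro h; rw [h] at hS; simp at hS
        · rw [← Finset.add_sum_erase S _ haS] at hsum ⊢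
          rw [Function.update_self]
          have : ∑ r ∈ S.erase a, (2 * g r - g (p r) - g (Function.update q a (B + 1) r))
              = ∑ r ∈ S.erase a, (2 * g r - g (p r) - g (q r)) := by
            apply Finset.sum_congr rfl
            intro r hr
            rw [hq' r (Finset.ne_of_mem_erase hr)]
          rw [this]
          rw [hqa] at hsum
          linarith

lemma core {u g : ℤ → ℝ} (hd : Dom u g) {V : ℝ}
    (hatt : ∀ p r, g p < g r → ∃ w, Att u g r w)
    (hrange : ∀ x y, g x - g y ≤ V)
    (hV : ∀ s : Finset ℤ, ∑ c ∈ s, |u (c + 1) - u c| ≤ V) {A B : ℤ} (hAB : A ≤ B) :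
    ∑ k ∈ Finset.Ico A B, |g (k + 1) - g k| ≤ (4 + 1286 * 132096) * V := by
  obtain ⟨S, p, q, s, s1, hpk, hord, hsB, hgs, hqs, hlast, hs1, hsum⟩ := peaks_exist g A B hAB
  have hw : ∀ r, ∃ w, r ∈ S → Att u g r w := by
    intro r
    by_cases hr : r ∈ S
    · obtain ⟨w, h⟩ := hatt _ _ (hpk r hr).2.2.1
      exact ⟨w, fun _ => h⟩
    · exact ⟨0, fun h => absurd h hr⟩
  choose w hw using hw
  have h1 := peaks_sum hd S p q w hw hpk hord hV
  have h2 := hrange A s1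
  have h3 := hrange B s
  linarith

/-! ### The maximal function -/

lemma avg_eq (u : ℤ → ℝ) (n : ℤ) (r : ℕ) :
    avg u (n - r) (n + r) = (∑ k ∈ Finset.Ico (n - r) (n + r + 1), u k) / (2 * r + 1) := by
  unfold avg
  have e : Finset.Icc (n - (r : ℤ)) (n + r) = Finset.Ico (n - (r : ℤ)) (n + r + 1) := by
    ext k; simp only [Finset.mem_Icc, Finset.mem_Ico]; omega
  rw [e]
  congr 1
  push_cast
  ring

lemma card_win (n : ℤ) (r : ℕ) :
    ((Finset.Ico (n - (r : ℤ)) (n + r + 1)).card : ℝ) = 2 * r + 1 := by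
  have : ((Finset.Ico (n - (r : ℤ)) (n + r + 1)).card : ℤ) = 2 * r + 1 := by
    rw [Int.card_Ico_of_le _ _ (by omega)]; ring
  exact_mod_cast this

lemma avg_le (u : ℤ → ℝ) {K : ℝ} (hK : ∀ k, u k ≤ K) (n : ℤ) (r : ℕ) :
    avg u (n - r) (n + r) ≤ K := by
  rw [avg_eq, div_le_iff₀ (by positivity)]
  refine (Finset.sum_le_card_nsmul _ _ K (fun k _ => hK k)).trans ?_
  rw [nsmul_eq_mul, card_win, mul_comm]

lemma stmt_aux (f : ℤ → ℝ) (hf : BddVar f) {A B : ℤ} (hAB : A ≤ B) :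
    ∑ k ∈ Finset.Ico A B, |dM f (k + 1) - dM f k| ≤ (4 + 1286 * 132096) * dVar f := by
  set u : ℤ → ℝ := fun k => |f k| with hu
  have hV : ∀ s : Finset ℤ, ∑ c ∈ s, |u (c + 1) - u c| ≤ dVar f := by
    intro s
    refine (Finset.sum_le_sum (fun c _ => abs_abs_sub_abs_le_abs_sub (f (c + 1)) (f c))).trans ?_
    exact hf.sum_le_tsum s (fun _ _ => abs_nonneg _)
  have hu0 : ∀ k, 0 ≤ u k := fun k => abs_nonneg _
  have hosc : ∀ x y, u x ≤ u y + dVar f := by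
    intro x y
    rcases le_total x y with h | h
    · have h1 := sub_le_sum_abs u h
      have h2 := hV (Finset.Ico x y)
      have h3 := neg_abs_le (u y - u x)
      linarith
    · have h1 := sub_le_sum_abs u h
      have h2 := hV (Finset.Ico y x)
      have h3 := le_abs_self (u x - u y)
      linarith
  have hle : ∀ n K, (∀ k, u k ≤ K) → dM f n ≤ K := by
    intro n K hK
    exact ciSup_le (fun r => avg_le u hK n r)
  have hbdd : ∀ n, BddAbove (Set.range fun r : ℕ => avg u (n - r) (n + r)) := by
    intro n
    refine ⟨u 0 + dVar f, ?_⟩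
    rintro _ ⟨r, rfl⟩
    exact avg_le u (fun k => hosc k 0) n r
  have hge : ∀ n (r : ℕ), avg u (n - r) (n + r) ≤ dM f n := fun n r => le_ciSup (hbdd n) r
  have hd : Dom u (dM f) := by
    intro n w hw
    lift w to ℕ using hw
    have := hge n w
    rw [avg_eq, div_le_iff₀ (by positivity)] at this
    push_cast
    linarith
  have hrange : ∀ x y, dM f x - dM f y ≤ dVar f := by
    intro x y
    have h1 := hle x (u y + dVar f) (fun k => hosc k y)
    have h2 := hd.le y
    linarith
  have hatt : ∀ p r, dM f p < dM f r → ∃ w, Att u (dM f) r w := by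
    intro p r hpr
    obtain ⟨D, hD⟩ : ∃ D : ℕ, (D : ℤ) = |r - p| := ⟨(r - p).natAbs, by simp⟩
    have hD1 := le_abs_self (r - p)
    have hD2 := neg_abs_le (r - p)
    rw [← hD] at hD1 hD2
    have hp0 : 0 ≤ dM f p := (hu0 p).trans (hd.le p)
    obtain ⟨W, hW⟩ := exists_nat_ge (2 * D * dM f p / ((dM f r - dM f p) / 2))
    rw [div_le_iff₀ (by linarith)] at hW
    have hfar : ∀ w : ℕ, W ≤ w → avg u (r - w) (r + w) ≤ (dM f p + dM f r) / 2 := by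
      intro w hw
      have hw' : (W : ℝ) ≤ w := by exact_mod_cast hw
      rw [avg_eq, div_le_iff₀ (by positivity)]
      have h1 : ∑ k ∈ Finset.Ico (r - (w : ℤ)) (r + w + 1), u k ≤
          ∑ k ∈ Finset.Ico (p - ((w : ℤ) + D)) (p + ((w : ℤ) + D) + 1), u k := by
        apply Finset.sum_le_sum_of_subset_of_nonneg
        · apply Finset.Ico_subset_Ico <;> linarith
        · intro k _ _; exact hu0 k
      have h2 := hd p ((w : ℤ) + D) (by positivity)
      push_cast at h2
      nlinarith
    obtain ⟨w, hw, hmax⟩ := Finset.exists_max_image (Finset.range (W + 1))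
      (fun w : ℕ => avg u (r - w) (r + w)) ⟨0, by simp⟩
    have hsup : dM f r ≤ max (avg u (r - w) (r + w)) ((dM f p + dM f r) / 2) := by
      apply ciSup_le
      intro v
      by_cases hv : v ∈ Finset.range (W + 1)
      · exact le_max_of_le_left (hmax v hv)
      · rw [Finset.mem_range] at hv
        exact le_max_of_le_right (hfar v (by omega))
    have hw2 : dM f r ≤ avg u (r - w) (r + w) := by
      rcases le_max_iff.1 hsup with h | h
      · exact h
      · linarith
    have heq := le_antisymm (hge r w) hw2
    rw [avg_eq, div_eq_iff (by positivity)] at heq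
    refine ⟨w, by positivity, ?_⟩
    rw [heq]
    push_cast
    ring
  exact core hd hatt hrange hV hAB

/-- there is an absolute constant `C > 0` (the proof yields
`C = 2·120·2^12·300 + 4 = 294912004`) such that for every `f : ℤ → ℝ` of bounded
variation, `Var (Mf) ≤ C · Var f` (in particular `Mf` has bounded variation). -/
theorem stmt0 :
    ∃ C : ℝ, 0 < C ∧ ∀ f : ℤ → ℝ, BddVar f →
      BddVar (dM f) ∧ dVar (dM f) ≤ C * dVar f := by
  refine ⟨4 + 1286 * 132096, by norm_num, fun f hf => ?_⟩
  have hfin : ∀ s : Finset ℤ, ∑ k ∈ s, |dM f (k + 1) - dM f k| ≤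
      (4 + 1286 * 132096) * dVar f := by
    intro s
    have hsub : ∃ A B : ℤ, A ≤ B ∧ s ⊆ Finset.Ico A B := by
      rcases s.eq_empty_or_nonempty with h | h
      · exact ⟨0, 0, le_rfl, by simp [h]⟩
      · refine ⟨s.min' h, s.max' h + 1, ?_, ?_⟩
        · have := s.min'_le_max' h
          linarith
        · intro x hx
          rw [Finset.mem_Ico]
          have h1 := s.min'_le x hx
          have h2 := s.le_max' x hx
          exact ⟨h1, by linarith⟩
    obtain ⟨A, B, hAB, hs⟩ := hsub
    exact (Finset.sum_le_sum_of_subset_of_nonneg hs (fun _ _ _ => abs_nonneg _)).trans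
      (stmt_aux f hf hAB)
  exact ⟨summable_of_sum_le (fun _ => abs_nonneg _) hfin,
    Real.tsum_le_of_sum_le (fun _ => abs_nonneg _) hfin⟩

end
end

section
/- Let f : ℤ → ℝ be nonnegative with bounded variation, let L be a positive even integer, and let [x,y] be an interval of length L (y = x + L). Let 𝕡_i = {p_i < r_i < q_i}, 1 ≤ i ≤ m, be essential peaks for f satisfying x ≤ r_1 < q_1 ≤ p_2 < r_2 < q_2 ≤ … ≤ p_m < r_m ≤ y and 32L < ω(r_i) ≤ 64L for 1 ≤ i ≤ m. Then there exist integers s < u < v < t such that x − 64L ≤ s, t ≤ y + 64L, u − s ≥ 4L, v − u = L, t − v ≥ 4L, and min{f(s), f(t)} − A_{u,v}f ≥ (1/12) ∑_{i=1}^m Var 𝕡_i. -/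
open Finset

noncomputable section

/-- A function of bounded variation is bounded. -/
lemma bdd_of_bv (f : ℤ → ℝ) (hbv : BddVar f) : ∃ C : ℝ, ∀ n, |f n| ≤ C := by
  unfold BddVar at hbv
  refine ⟨|f 0| + ∑' k : ℤ, |f (k + 1) - f k|, ?_⟩
  have key : ∀ (x : ℤ) (n : ℕ), |f (x + n) - f x| ≤ ∑ k ∈ Finset.Ico x (x + n), |f (k + 1) - f k| := by
    intro x n
    induction n with
    | zero => simp
    | succ n ih =>
      have h1 : Finset.Ico x (x + (n + 1 : ℕ)) = insert (x + n) (Finset.Ico x (x + n)) := by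
        ext k; simp only [Finset.mem_Ico, Finset.mem_insert]; push_cast; omega
      rw [h1, Finset.sum_insert (by simp)]
      have h2 : f (x + (n + 1 : ℕ)) - f x = (f (x + n + 1) - f (x + n)) + (f (x + n) - f x) := by
        push_cast; rw [← add_assoc]; ring
      rw [h2]
      exact (abs_add_le _ _).trans (by linarith)
  have key2 : ∀ (x : ℤ) (n : ℕ), |f (x + n) - f x| ≤ ∑' k : ℤ, |f (k + 1) - f k| := fun x n =>
    (key x n).trans (hbv.sum_le_tsum _ (fun _ _ => abs_nonneg _))
  intro n
  rcases le_total 0 n with h | h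
  · obtain ⟨k, rfl⟩ := Int.eq_ofNat_of_zero_le h
    have := key2 0 k
    rw [zero_add] at this
    have h3 := abs_sub_abs_le_abs_sub (f k) (f 0)
    linarith
  · obtain ⟨k, hk⟩ := Int.eq_ofNat_of_zero_le (show 0 ≤ -n by omega)
    have := key2 n k
    rw [show n + (k : ℤ) = 0 by omega] at this
    have h3 := abs_sub_abs_le_abs_sub (f n) (f 0)
    rw [abs_sub_comm] at h3
    linarith

lemma avg_le_dM (f : ℤ → ℝ) (hf : ∀ n, 0 ≤ f n) (hbv : BddVar f) (n w : ℤ) (hw : 0 ≤ w) :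
    avg f (n - w) (n + w) ≤ dM f n := by
  obtain ⟨C, hC⟩ := bdd_of_bv f hbv
  have habs : (fun k => |f k|) = f := by
    funext k; exact abs_of_nonneg (hf k)
  unfold dM
  rw [habs]
  obtain ⟨k, rfl⟩ := Int.eq_ofNat_of_zero_le hw
  refine le_ciSup (f := fun r : ℕ => avg f (n - r) (n + r)) ?_ k
  refine ⟨C, ?_⟩
  rintro _ ⟨j, rfl⟩
  simp only [avg]
  have hpos : (0 : ℝ) < ((n + (j : ℤ) - (n - j) + 1 : ℤ) : ℝ) := by
    exact_mod_cast (by omega : (0 : ℤ) < n + (j : ℤ) - (n - j) + 1)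
  rw [div_le_iff₀ hpos]
  calc ∑ k ∈ Finset.Icc (n - (j : ℤ)) (n + j), f k
      ≤ ∑ k ∈ Finset.Icc (n - (j : ℤ)) (n + j), C :=
        Finset.sum_le_sum (fun k _ => (le_abs_self _).trans (hC k))
    _ = _ := by
      rw [Finset.sum_const, Int.card_Icc, nsmul_eq_mul, mul_comm]
      congr 1
      have : ((n + (j : ℤ) + 1 - (n - j)).toNat : ℤ) = n + (j : ℤ) - (n - j) + 1 := by omega
      exact_mod_cast this

lemma sum_le_dM (f : ℤ → ℝ) (hf : ∀ n, 0 ≤ f n) (hbv : BddVar f) (n w : ℤ) (hw : 0 ≤ w) :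
    ∑ k ∈ Finset.Icc (n - w) (n + w), f k ≤ (2 * w + 1) * dM f n := by
  have h := avg_le_dM f hf hbv n w hw
  unfold avg at h
  have hw' : (0 : ℝ) ≤ w := by exact_mod_cast hw
  rw [div_le_iff₀ (by push_cast; linarith)] at h
  push_cast at h
  linarith

lemma sum_eq_radius (f : ℤ → ℝ) (r w : ℤ) (h : IsRadius f r w) :
    ∑ k ∈ Finset.Icc (r - w) (r + w), f k = (2 * w + 1) * dM f r := by
  obtain ⟨h0, h, -⟩ := h
  unfold avg at h
  have hw' : (0 : ℝ) < w := by exact_mod_cast h0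
  rw [div_eq_iff (by push_cast; linarith)] at h
  rw [h]; push_cast; ring

/-- Sums over a nonempty interval are bounded by length times some value. -/
lemma exists_ge_sum (f : ℤ → ℝ) (x y : ℤ) (h : x ≤ y) :
    ∃ s, x ≤ s ∧ s ≤ y ∧ ∑ k ∈ Finset.Icc x y, f k ≤ (y - x + 1) * f s := by
  obtain ⟨s, hs, hmax⟩ := Finset.exists_max_image (Finset.Icc x y) f ⟨x, by simp [h]⟩
  rw [Finset.mem_Icc] at hs
  refine ⟨s, hs.1, hs.2, ?_⟩
  calc ∑ k ∈ Finset.Icc x y, f k ≤ ∑ k ∈ Finset.Icc x y, f s := Finset.sum_le_sum hmax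
    _ = _ := by
      rw [Finset.sum_const, Int.card_Icc, nsmul_eq_mul]
      congr 1
      have : ((y + 1 - x).toNat : ℤ) = y - x + 1 := by omega
      exact_mod_cast this

lemma sum_split (f : ℤ → ℝ) (x y z : ℤ) (h1 : x ≤ y) (h2 : y ≤ z) :
    ∑ k ∈ Finset.Icc x z, f k = ∑ k ∈ Finset.Icc x (y - 1), f k + ∑ k ∈ Finset.Icc y z, f k := by
  rw [← Finset.sum_union]
  · congr 1
    ext k; simp only [Finset.mem_Icc, Finset.mem_union]; omega
  · rw [Finset.disjoint_left]
    intro k; simp only [Finset.mem_Icc]; omega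

lemma pairS (f : ℤ → ℝ) (hf : ∀ n, 0 ≤ f n) (hbv : BddVar f) (r w z : ℤ) (h : IsRadius f r w)
    (hz : r < z) (hzw : z - r ≤ w) :
    ∃ s, r - w ≤ s ∧ s ≤ r - w + 2 * (z - r) - 1 ∧
      (2 * w + 1) * dM f r ≤ 2 * (z - r) * f s + (2 * w + 1 - 2 * (z - r)) * dM f z := by
  obtain ⟨s, h1, h2, h3⟩ := exists_ge_sum f (r - w) (r - w + 2 * (z - r) - 1) (by omega)
  refine ⟨s, h1, h2, ?_⟩
  have e := sum_eq_radius f r w h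
  rw [sum_split f (r - w) (r - w + 2 * (z - r)) (r + w) (by omega) (by omega)] at e
  have e2 := sum_le_dM f hf hbv z (w - (z - r)) (by omega)
  rw [show z - (w - (z - r)) = r - w + 2 * (z - r) by ring,
    show z + (w - (z - r)) = r + w by ring] at e2
  push_cast at h3 e2
  linarith

lemma pairT (f : ℤ → ℝ) (hf : ∀ n, 0 ≤ f n) (hbv : BddVar f) (r w z : ℤ) (h : IsRadius f r w)
    (hz : z < r) (hzw : r - z ≤ w) :
    ∃ t, r + w - 2 * (r - z) + 1 ≤ t ∧ t ≤ r + w ∧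
      (2 * w + 1) * dM f r ≤ 2 * (r - z) * f t + (2 * w + 1 - 2 * (r - z)) * dM f z := by
  obtain ⟨s, h1, h2, h3⟩ := exists_ge_sum f (r + w - 2 * (r - z) + 1) (r + w) (by omega)
  refine ⟨s, h1, h2, ?_⟩
  have e := sum_eq_radius f r w h
  rw [sum_split f (r - w) (r + w - 2 * (r - z) + 1) (r + w) (by omega) (by omega)] at e
  have e2 := sum_le_dM f hf hbv z (w - (r - z)) (by omega)
  rw [show z - (w - (r - z)) = r - w by ring,
    show z + (w - (r - z)) = r + w - 2 * (r - z) + 1 - 1 by ring] at e2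
  push_cast at h3 e2
  linarith

/-- the linear consequence of `pairS`, `pairT` -/
lemma pair_ge {w d M N v : ℝ} (hd : 0 < d) (hdw : d ≤ w) (hMN : N ≤ M)
    (h : (2 * w + 1) * M ≤ 2 * d * v + (2 * w + 1 - 2 * d) * N) : M ≤ v := by
  have : (2 * w + 1 - 2 * d) * N ≤ (2 * w + 1 - 2 * d) * M :=
    mul_le_mul_of_nonneg_left hMN (by linarith)
  by_contra hc
  push Not at hc
  nlinarith

lemma pair_slope {w d M N v H μ L : ℝ} (hL : 0 < L) (hd : 0 < d) (hw : 32 * L ≤ w)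
    (hv : v ≤ H) (hN : μ ≤ N) (hH : μ ≤ H)
    (h : (2 * w + 1) * M ≤ 2 * d * v + (2 * w + 1 - 2 * d) * N) :
    M - N ≤ (H - μ) / (32 * L) * d := by
  rw [div_mul_eq_mul_div, le_div_iff₀ (by linarith)]
  by_cases hc : M ≤ N
  · have : 0 ≤ (H - μ) * d := mul_nonneg (by linarith) hd.le
    nlinarith
  · push Not at hc
    have h1 : (2 * w + 1) * (M - N) ≤ 2 * d * (H - μ) := by nlinarith
    nlinarith

lemma farS (f : ℤ → ℝ) (hf : ∀ n, 0 ≤ f n) (hbv : BddVar f) (p r q w : ℤ)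
    (hp : IsEssentialPeak f p r q) (h : IsRadius f r w) :
    ∃ s, r - w ≤ s ∧ s ≤ p ∧ s ≤ r - w + 2 * (q - r) - 1 ∧ dM f r ≤ f s := by
  obtain ⟨⟨h1, h2, h3, h4⟩, h5⟩ := hp
  have hv : 0 < peakVar f p r q := by unfold peakVar; linarith
  have hw := h.1
  by_cases hc : q - r ≤ w
  · obtain ⟨s, a1, a2, a3⟩ := pairS f hf hbv r w q h h2 hc
    have hge : dM f r ≤ f s := by
      refine pair_ge (d := (q : ℝ) - r) (w := w) ?_ ?_ h4.le a3
      · have : (r : ℝ) < q := by exact_mod_cast h2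
        linarith
      · exact_mod_cast hc
    refine ⟨s, a1, ?_, a2, hge⟩
    by_contra hsp
    have := h5 s (by omega) (by omega)
    linarith
  · obtain ⟨s, a1, a2, a3⟩ := exists_ge_sum f (r - w) (r + w) (by omega)
    rw [sum_eq_radius f r w h] at a3
    have hw' : (0 : ℝ) < w := by exact_mod_cast hw
    have hge : dM f r ≤ f s := by
      push_cast at a3
      refine le_of_mul_le_mul_left (a := 2 * (w : ℝ) + 1) ?_ (by linarith)
      linarith
    refine ⟨s, a1, ?_, by omega, hge⟩
    by_contra hsp
    have := h5 s (by omega) (by omega)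
    linarith

lemma farT (f : ℤ → ℝ) (hf : ∀ n, 0 ≤ f n) (hbv : BddVar f) (p r q w : ℤ)
    (hp : IsEssentialPeak f p r q) (h : IsRadius f r w) :
    ∃ t, t ≤ r + w ∧ q ≤ t ∧ r + w - 2 * (r - p) + 1 ≤ t ∧ dM f r ≤ f t := by
  obtain ⟨⟨h1, h2, h3, h4⟩, h5⟩ := hp
  have hv : 0 < peakVar f p r q := by unfold peakVar; linarith
  have hw := h.1
  by_cases hc : r - p ≤ w
  · obtain ⟨s, a1, a2, a3⟩ := pairT f hf hbv r w p h h1 hc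
    have hge : dM f r ≤ f s := by
      refine pair_ge (d := (r : ℝ) - p) (w := w) ?_ ?_ h3.le a3
      · have : (p : ℝ) < r := by exact_mod_cast h1
        linarith
      · exact_mod_cast hc
    refine ⟨s, a2, ?_, a1, hge⟩
    by_contra hsp
    have := h5 s (by omega) (by omega)
    linarith
  · obtain ⟨s, a1, a2, a3⟩ := exists_ge_sum f (r - w) (r + w) (by omega)
    rw [sum_eq_radius f r w h] at a3
    have hw' : (0 : ℝ) < w := by exact_mod_cast hw
    have hge : dM f r ≤ f s := by
      push_cast at a3
      refine le_of_mul_le_mul_left (a := 2 * (w : ℝ) + 1) ?_ (by linarith)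
      linarith
    refine ⟨s, a2, ?_, by omega, hge⟩
    by_contra hsp
    have := h5 s (by omega) (by omega)
    linarith

lemma avg_le_of_le (f : ℤ → ℝ) (u v : ℤ) (B : ℝ) (huv : u ≤ v)
    (h : ∀ k, u ≤ k → k ≤ v → f k ≤ B) : avg f u v ≤ B := by
  obtain ⟨s, h1, h2, h3⟩ := exists_ge_sum f u v huv
  unfold avg
  have huv' : (u : ℝ) ≤ v := by exact_mod_cast huv
  rw [div_le_iff₀ (by push_cast; linarith)]
  push_cast
  have := mul_le_mul_of_nonneg_left (h s h1 h2) (show (0 : ℝ) ≤ v - u + 1 by linarith)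
  linarith

/-- One peak with a far endpoint. -/
lemma far_case (f : ℤ → ℝ) (hf : ∀ n, 0 ≤ f n) (hbv : BddVar f) (L p r q w : ℤ) (hL : 0 < L)
    (hp : IsEssentialPeak f p r q) (h : IsRadius f r w) (hw : 32 * L < w)
    (hfar : 8 * L < r - p ∨ 8 * L < q - r) :
    ∃ s u v t : ℤ, s < u ∧ u < v ∧ v < t ∧
      r - w ≤ s ∧ t ≤ r + w ∧
      4 * L ≤ u - s ∧ v - u = L ∧ 4 * L ≤ t - v ∧
      min (f s) (f t) - avg f u v ≥ (1 / 4 : ℝ) * peakVar f p r q := by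
  obtain ⟨s, s1, s2, s3, s4⟩ := farS f hf hbv p r q w hp h
  obtain ⟨t, t1, t2, t3, t4⟩ := farT f hf hbv p r q w hp h
  obtain ⟨⟨h1, h2, h3, h4⟩, h5⟩ := hp
  have key : ∃ u v, p < u ∧ v < q ∧ 4 * L ≤ u - s ∧ v - u = L ∧ 4 * L ≤ t - v := by
    rcases hfar with hc | hc
    · by_cases hd : r - p ≤ 10 * L
      · exact ⟨r - L, r, by omega, by omega, by omega, by omega, by omega⟩
      · exact ⟨r - 5 * L, r - 4 * L, by omega, by omega, by omega, by omega, by omega⟩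
    · by_cases hd : q - r ≤ 10 * L
      · exact ⟨r, r + L, by omega, by omega, by omega, by omega, by omega⟩
      · exact ⟨r + 4 * L, r + 5 * L, by omega, by omega, by omega, by omega, by omega⟩
  obtain ⟨u, v, k1, k2, k3, k4, k5⟩ := key
  refine ⟨s, u, v, t, by omega, by omega, by omega, s1, t1, k3, k4, k5, ?_⟩
  have := avg_le_of_le f u v _ (by omega) (fun k hk1 hk2 => h5 k (by omega) (by omega))
  have h6 := le_min s4 t4
  linarith

lemma comb_up (F : ℤ → ℝ) (p r q : ℕ → ℤ) (σ : ℝ) (hσ : 0 ≤ σ) (a b : ℕ) (hab : a ≤ b)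
    (hpr : ∀ i, a ≤ i → i ≤ b → p i < r i ∧ r i < q i)
    (hch : ∀ i, a ≤ i → i < b → q i ≤ p (i + 1))
    (hup : ∀ i, a ≤ i → i ≤ b → F (r i) - F (p i) ≤ σ * (r i - p i))
    (hup' : ∀ i, a ≤ i → i < b → F (r (i + 1)) - F (q i) ≤ σ * (r (i + 1) - q i)) :
    ∑ i ∈ Finset.Icc a b, (2 * F (r i) - F (p i) - F (q i)) ≤
      F (r a) - F (q b) + σ * (2 * r b - r a - p a) := by
  induction b, hab using Nat.le_induction with
  | base =>
    simp only [Finset.Icc_self, Finset.sum_singleton]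
    have := hup a le_rfl le_rfl
    linarith
  | succ b hab ih =>
    have ih := ih (fun i h1 h2 => hpr i h1 (by omega)) (fun i h1 h2 => hch i h1 (by omega))
      (fun i h1 h2 => hup i h1 (by omega)) (fun i h1 h2 => hup' i h1 (by omega))
    rw [← Finset.insert_Icc_right_eq_Icc_add_one (by omega), Finset.sum_insert (by simp)]
    have e1 := hup (b + 1) (by omega) le_rfl
    have e2 := hup' b hab (by omega)
    have hq := (hpr b hab (by omega)).2
    have hc := hch b hab (by omega)
    have c1 : (r b : ℝ) ≤ q b := by exact_mod_cast hq.le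
    have c2 : (q b : ℝ) ≤ p (b + 1) := by exact_mod_cast hc
    have := mul_nonneg hσ (sub_nonneg.2 c1)
    have := mul_nonneg hσ (sub_nonneg.2 c2)
    linarith

lemma comb_down (F : ℤ → ℝ) (p r q : ℕ → ℤ) (σ : ℝ) (hσ : 0 ≤ σ) (a b : ℕ) (hab : a ≤ b)
    (hpr : ∀ i, a ≤ i → i ≤ b → p i < r i ∧ r i < q i)
    (hch : ∀ i, a ≤ i → i < b → q i ≤ p (i + 1))
    (hup : ∀ i, a ≤ i → i ≤ b → F (r i) - F (q i) ≤ σ * (q i - r i))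
    (hup' : ∀ i, a ≤ i → i < b → F (r i) - F (p (i + 1)) ≤ σ * (p (i + 1) - r i)) :
    ∑ i ∈ Finset.Icc a b, (2 * F (r i) - F (p i) - F (q i)) ≤
      F (r b) - F (p a) + σ * (r b + q b - 2 * r a) := by
  induction b, hab using Nat.le_induction with
  | base =>
    simp only [Finset.Icc_self, Finset.sum_singleton]
    have := hup a le_rfl le_rfl
    linarith
  | succ b hab ih =>
    have ih := ih (fun i h1 h2 => hpr i h1 (by omega)) (fun i h1 h2 => hch i h1 (by omega))
      (fun i h1 h2 => hup i h1 (by omega)) (fun i h1 h2 => hup' i h1 (by omega))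
    rw [← Finset.insert_Icc_right_eq_Icc_add_one (by omega), Finset.sum_insert (by simp)]
    have e1 := hup (b + 1) (by omega) le_rfl
    have e2 := hup' b hab (by omega)
    have hq := (hpr (b + 1) (by omega) le_rfl).1
    have hc := hch b hab (by omega)
    have c1 : (p (b + 1) : ℝ) ≤ r (b + 1) := by exact_mod_cast hq.le
    have c2 : (q b : ℝ) ≤ p (b + 1) := by exact_mod_cast hc
    have := mul_nonneg hσ (sub_nonneg.2 c1)
    have := mul_nonneg hσ (sub_nonneg.2 c2)
    linarith

lemma r_le_r (p r q : ℕ → ℤ) (a b : ℕ)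
    (hpr : ∀ i, a ≤ i → i ≤ b → p i < r i ∧ r i < q i)
    (hch : ∀ i, a ≤ i → i < b → q i ≤ p (i + 1)) (i : ℕ) (ha : a ≤ i) (j : ℕ) (hij : i ≤ j) :
    j ≤ b → r i ≤ r j := by
  induction j, hij using Nat.le_induction with
  | base => intro _; exact le_rfl
  | succ j hj ih =>
    intro hb
    have := ih (by omega)
    have h1 := hch j (by omega) (by omega)
    have h2 := hpr j (by omega) (by omega)
    have h3 := hpr (j + 1) (by omega) (by omega)
    omega

lemma near_case (f : ℤ → ℝ) (hf : ∀ n, 0 ≤ f n) (hbv : BddVar f)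
    (L x : ℤ) (hL : 0 < L) (hLeven : Even L) (a b : ℕ) (hab : a ≤ b)
    (p r q ω : ℕ → ℤ)
    (hpk : ∀ i, a ≤ i → i ≤ b → IsPeak f (p i) (r i) (q i))
    (hrad : ∀ i, a ≤ i → i ≤ b → IsRadius f (r i) (ω i))
    (hωlb : ∀ i, a ≤ i → i ≤ b → 32 * L < ω i)
    (hωub : ∀ i, a ≤ i → i ≤ b → ω i ≤ 64 * L)
    (hx : x ≤ r a) (hy : r b ≤ x + L)
    (hpa : r a - p a ≤ 8 * L) (hqb : q b - r b ≤ 8 * L)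
    (hch : ∀ i, a ≤ i → i < b → q i ≤ p (i + 1)) :
    ∃ s u v t : ℤ, s < u ∧ u < v ∧ v < t ∧
      x - 64 * L ≤ s ∧ t ≤ x + L + 64 * L ∧
      4 * L ≤ u - s ∧ v - u = L ∧ 4 * L ≤ t - v ∧
      min (f s) (f t) - avg f u v ≥
        (1 / 4 : ℝ) * ∑ i ∈ Finset.Icc a b, peakVar f (p i) (r i) (q i) := by
  have hpr : ∀ i, a ≤ i → i ≤ b → p i < r i ∧ r i < q i :=
    fun i h1 h2 => ⟨(hpk i h1 h2).1, (hpk i h1 h2).2.1⟩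
  have hrx : ∀ i, a ≤ i → i ≤ b → x ≤ r i ∧ r i ≤ x + L := fun i h1 h2 =>
    ⟨hx.trans (r_le_r p r q a b hpr hch a le_rfl i h1 h2),
      (r_le_r p r q a b hpr hch i h1 b h2 le_rfl).trans hy⟩
  have hpi : ∀ i, a ≤ i → i ≤ b → x - 8 * L ≤ p i ∧ r i - p i ≤ 8 * L := by
    intro i h1 h2
    rcases Nat.eq_or_lt_of_le h1 with rfl | h1'
    · omega
    · obtain ⟨j, rfl⟩ : ∃ j, i = j + 1 := ⟨i - 1, by omega⟩
      have := hch j (by omega) (by omega)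
      have := hpr j (by omega) (by omega)
      have := hrx j (by omega) (by omega)
      have := hrx (j + 1) (by omega) (by omega)
      omega
  have hqi : ∀ i, a ≤ i → i ≤ b → q i ≤ x + 9 * L ∧ q i - r i ≤ 8 * L := by
    intro i h1 h2
    rcases Nat.eq_or_lt_of_le h2 with rfl | h2'
    · omega
    · have := hch i (by omega) (by omega)
      have := hpr (i + 1) (by omega) (by omega)
      have := hrx i (by omega) (by omega)
      have := hrx (i + 1) (by omega) (by omega)
      omega
  obtain ⟨c, hc, hmin⟩ := Finset.exists_min_image
    ((Finset.Icc a b).image p ∪ (Finset.Icc a b).image q) (dM f)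
    ⟨p a, by simp only [Finset.mem_union, Finset.mem_image, Finset.mem_Icc]; exact Or.inl ⟨a, by omega, rfl⟩⟩
  have hminp : ∀ i, a ≤ i → i ≤ b → dM f c ≤ dM f (p i) := fun i h1 h2 => hmin _ (by
    simp only [Finset.mem_union, Finset.mem_image, Finset.mem_Icc]; exact Or.inl ⟨i, ⟨h1, h2⟩, rfl⟩)
  have hminq : ∀ i, a ≤ i → i ≤ b → dM f c ≤ dM f (q i) := fun i h1 h2 => hmin _ (by
    simp only [Finset.mem_union, Finset.mem_image, Finset.mem_Icc]; exact Or.inr ⟨i, ⟨h1, h2⟩, rfl⟩)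
  have hcx : x - 8 * L ≤ c ∧ c ≤ x + 9 * L := by
    simp only [Finset.mem_union, Finset.mem_image, Finset.mem_Icc] at hc
    rcases hc with ⟨i, ⟨h1, h2⟩, rfl⟩ | ⟨i, ⟨h1, h2⟩, rfl⟩
    · have := hpi i h1 h2
      have := hrx i h1 h2
      have := hpr i h1 h2
      omega
    · have := hqi i h1 h2
      have := hrx i h1 h2
      have := hpr i h1 h2
      omega
  clear hc hmin
  obtain ⟨h, hh⟩ := hLeven
  set μ := dM f c with hμ
  set T := ∑ i ∈ Finset.Icc a b, peakVar f (p i) (r i) (q i) with hT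
  have hTpos : 0 < T := by
    refine Finset.sum_pos (fun i hi => ?_) ⟨a, by simp [hab]⟩
    rw [Finset.mem_Icc] at hi
    obtain ⟨-, -, h3, h4⟩ := hpk i hi.1 hi.2
    unfold peakVar; linarith
  have hLr : (0 : ℝ) < L := by exact_mod_cast hL
  obtain ⟨H, hH⟩ : ∃ H, H = μ + T / 4 := ⟨_, rfl⟩
  have hσ : 0 ≤ (H - μ) / (32 * (L : ℝ)) := div_nonneg (by linarith) (by linarith)
  have hσL : (H - μ) / (32 * (L : ℝ)) * L = T / 128 := by
    rw [hH]; field_simp; ring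
  have hS : ∃ s, x - 64 * L ≤ s ∧ s ≤ x + L - 16 * L ∧ H ≤ f s := by
    by_contra! hcon
    have slope : ∀ i, a ≤ i → i ≤ b → ∀ z, r i < z → z - r i ≤ 8 * L → μ ≤ dM f z →
        dM f (r i) - dM f z ≤ (H - μ) / (32 * (L : ℝ)) * (z - r i) := by
      intro i h1 h2 z hz hz2 hz3
      have hw := hωlb i h1 h2
      have hw2 := hωub i h1 h2
      have := hrx i h1 h2
      obtain ⟨s, s1, s2, s3⟩ := pairS f hf hbv (r i) (ω i) z (hrad i h1 h2) hz (by omega)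
      refine pair_slope (v := f s) hLr ?_ ?_ (hcon s (by omega) (by omega)).le hz3 (by linarith) s3
      · have : (r i : ℝ) < z := by exact_mod_cast hz
        linarith
      · exact_mod_cast hw.le
    have hM : dM f (r b) ≤ H := by
      have hw := hωlb b hab le_rfl
      have hw2 := hωub b hab le_rfl
      have := hrx b hab le_rfl
      have hz := (hpr b hab le_rfl).2
      obtain ⟨s, s1, s2, s3⟩ := pairS f hf hbv (r b) (ω b) (q b) (hrad b hab le_rfl) hz (by omega)
      refine (pair_ge (v := f s) ?_ ?_ (hpk b hab le_rfl).2.2.2.le s3).trans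
        (hcon s (by omega) (by omega)).le
      · have : (r b : ℝ) < q b := by exact_mod_cast hz
        linarith
      · exact_mod_cast (by omega : q b - r b ≤ ω b)
    have := comb_down (dM f) p r q _ hσ a b hab hpr hch
      (fun i h1 h2 => slope i h1 h2 (q i) (hpr i h1 h2).2 (hqi i h1 h2).2 (hminq i h1 h2))
      (fun i h1 h2 => by
        have e1 := hpr i h1 h2.le
        have e2 := hch i h1 h2
        have e3 := hpr (i + 1) (by omega) (by omega)
        have e4 := hrx (i + 1) (by omega) (by omega)
        have e5 := hrx i h1 h2.le
        exact slope i h1 h2.le (p (i + 1)) (by omega) (by omega) (hminp (i + 1) (by omega) (by omega)))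
    have hb : (r b : ℝ) + q b - 2 * r a ≤ 10 * L := by
      exact_mod_cast (by omega : r b + q b - 2 * r a ≤ 10 * L)
    have h2 := mul_le_mul_of_nonneg_left hb hσ
    have h3 := hminp a le_rfl hab
    change T ≤ _ at this
    linarith
  have hTT : ∃ t, t ≤ x + L + 64 * L ∧ x + 16 * L ≤ t ∧ H ≤ f t := by
    by_contra! hcon
    have slope : ∀ i, a ≤ i → i ≤ b → ∀ z, z < r i → r i - z ≤ 8 * L → μ ≤ dM f z →
        dM f (r i) - dM f z ≤ (H - μ) / (32 * (L : ℝ)) * (r i - z) := by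
      intro i h1 h2 z hz hz2 hz3
      have hw := hωlb i h1 h2
      have hw2 := hωub i h1 h2
      have := hrx i h1 h2
      obtain ⟨s, s1, s2, s3⟩ := pairT f hf hbv (r i) (ω i) z (hrad i h1 h2) hz (by omega)
      refine pair_slope (v := f s) hLr ?_ ?_ (hcon s (by omega) (by omega)).le hz3 (by linarith) s3
      · have : (z : ℝ) < r i := by exact_mod_cast hz
        linarith
      · exact_mod_cast hw.le
    have hM : dM f (r a) ≤ H := by
      have hw := hωlb a le_rfl hab
      have hw2 := hωub a le_rfl hab
      have := hrx a le_rfl hab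
      have hz := (hpr a le_rfl hab).1
      obtain ⟨s, s1, s2, s3⟩ := pairT f hf hbv (r a) (ω a) (p a) (hrad a le_rfl hab) hz (by omega)
      refine (pair_ge (v := f s) ?_ ?_ (hpk a le_rfl hab).2.2.1.le s3).trans
        (hcon s (by omega) (by omega)).le
      · have : (p a : ℝ) < r a := by exact_mod_cast hz
        linarith
      · exact_mod_cast (by omega : r a - p a ≤ ω a)
    have := comb_up (dM f) p r q _ hσ a b hab hpr hch
      (fun i h1 h2 => slope i h1 h2 (p i) (hpr i h1 h2).1 (hpi i h1 h2).2 (hminp i h1 h2))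
      (fun i h1 h2 => by
        have e1 := hpr i h1 h2.le
        have e2 := hch i h1 h2
        have e3 := hpr (i + 1) (by omega) (by omega)
        have e4 := hrx (i + 1) (by omega) (by omega)
        have e5 := hrx i h1 h2.le
        exact slope (i + 1) (by omega) (by omega) (q i) (by omega) (by omega) (hminq i h1 h2.le))
    have hb : 2 * (r b : ℝ) - r a - p a ≤ 10 * L := by
      exact_mod_cast (by omega : 2 * r b - r a - p a ≤ 10 * L)
    have h2 := mul_le_mul_of_nonneg_left hb hσ
    have h3 := hminq b hab le_rfl
    change T ≤ _ at this
    linarith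
  obtain ⟨s, s1, s2, s3⟩ := hS
  obtain ⟨t, t1, t2, t3⟩ := hTT
  refine ⟨s, c - h, c + h, t, by omega, by omega, by omega, s1, t1, by omega, by omega, by omega, ?_⟩
  have e1 := avg_le_dM f hf hbv c h (by omega)
  have e2 := le_min s3 t3
  linarith

/-- Lemma 2 of the paper. -/
theorem stmt3 (f : ℤ → ℝ) (hf : ∀ n, 0 ≤ f n) (hbv : BddVar f)
    (L x y : ℤ) (hL : 0 < L) (hLeven : Even L) (hxy : y = x + L)
    (m : ℕ) (hm : 1 ≤ m) (p r q ω : ℕ → ℤ)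
    (hpk : ∀ i ∈ Finset.Icc 1 m, IsEssentialPeak f (p i) (r i) (q i))
    (hrad : ∀ i ∈ Finset.Icc 1 m, IsRadius f (r i) (ω i))
    (hωlb : ∀ i ∈ Finset.Icc 1 m, 32 * L < ω i)
    (hωub : ∀ i ∈ Finset.Icc 1 m, ω i ≤ 64 * L)
    (hx : x ≤ r 1) (hy : r m ≤ y)
    (hchain : ∀ i ∈ Finset.Icc 1 (m - 1), q i ≤ p (i + 1)) :
    ∃ s u v t : ℤ, s < u ∧ u < v ∧ v < t ∧
      x - 64 * L ≤ s ∧ t ≤ y + 64 * L ∧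
      4 * L ≤ u - s ∧ v - u = L ∧ 4 * L ≤ t - v ∧
      min (f s) (f t) - avg f u v ≥
        (1 / 12 : ℝ) * ∑ i ∈ Finset.Icc 1 m, peakVar f (p i) (r i) (q i) := by
  subst hxy
  have hch : ∀ i, 1 ≤ i → i < m → q i ≤ p (i + 1) := fun i h1 h2 =>
    hchain i (Finset.mem_Icc.2 ⟨h1, by omega⟩)
  have hpr : ∀ i, 1 ≤ i → i ≤ m → p i < r i ∧ r i < q i := fun i h1 h2 =>
    have := hpk i (Finset.mem_Icc.2 ⟨h1, h2⟩)
    ⟨this.1.1, this.1.2.1⟩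
  have hrx : ∀ i, 1 ≤ i → i ≤ m → x ≤ r i ∧ r i ≤ x + L := fun i h1 h2 =>
    ⟨hx.trans (r_le_r p r q 1 m hpr hch 1 le_rfl i h1 h2),
      (r_le_r p r q 1 m hpr hch i h1 m h2 le_rfl).trans hy⟩
  obtain ⟨T, hT⟩ : ∃ T, T = ∑ i ∈ Finset.Icc 1 m, peakVar f (p i) (r i) (q i) := ⟨_, rfl⟩
  have hvpos : ∀ i ∈ Finset.Icc 1 m, 0 < peakVar f (p i) (r i) (q i) := by
    intro i hi
    obtain ⟨⟨-, -, h3, h4⟩, -⟩ := hpk i hi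
    unfold peakVar; linarith
  have hTpos : 0 < T := by
    rw [hT]; exact Finset.sum_pos hvpos ⟨1, by simp [hm]⟩
  rw [← hT]
  by_cases hbig : ∃ i, 1 ≤ i ∧ i ≤ m ∧ (8 * L < r i - p i ∨ 8 * L < q i - r i) ∧
      T / 3 ≤ peakVar f (p i) (r i) (q i)
  · obtain ⟨i, h1, h2, h3, h4⟩ := hbig
    have hi := Finset.mem_Icc.2 ⟨h1, h2⟩
    obtain ⟨s, u, v, t, a1, a2, a3, a4, a5, a6, a7, a8, a9⟩ :=
      far_case f hf hbv L (p i) (r i) (q i) (ω i) hL (hpk i hi) (hrad i hi) (hωlb i hi) h3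
    have := hωub i hi
    have := hrx i h1 h2
    exact ⟨s, u, v, t, a1, a2, a3, by omega, by omega, a6, a7, a8, by linarith⟩
  · push Not at hbig
    -- middle block of near peaks
    have hab : ∃ a b, 1 ≤ a ∧ a ≤ b ∧ b ≤ m ∧ r a - p a ≤ 8 * L ∧ q b - r b ≤ 8 * L ∧
        T / 3 ≤ ∑ i ∈ Finset.Icc a b, peakVar f (p i) (r i) (q i) := by
      have hmid : ∀ i, 1 ≤ i → i < m → q i - r i ≤ 8 * L ∧ r (i + 1) - p (i + 1) ≤ 8 * L := by
        intro i h1 h2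
        have := hch i h1 h2
        have := hpr i h1 h2.le
        have := hpr (i + 1) (by omega) h2
        have := hrx i h1 h2.le
        have := hrx (i + 1) (by omega) h2
        omega
      have hfirst : ∑ i ∈ Finset.Icc 1 m, peakVar f (p i) (r i) (q i) =
          peakVar f (p 1) (r 1) (q 1) + ∑ i ∈ Finset.Icc 2 m, peakVar f (p i) (r i) (q i) := by
        rw [← Finset.insert_Icc_add_one_left_eq_Icc hm, Finset.sum_insert (by simp)]
        rfl
      have hlast : ∀ a, a ≤ m → ∑ i ∈ Finset.Icc a m, peakVar f (p i) (r i) (q i) =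
          peakVar f (p m) (r m) (q m) +
            ∑ i ∈ Finset.Icc a (m - 1), peakVar f (p i) (r i) (q i) := by
        intro a ha
        obtain ⟨k, rfl⟩ : ∃ k, m = k + 1 := ⟨m - 1, by omega⟩
        rw [← Finset.insert_Icc_right_eq_Icc_add_one ha, Finset.sum_insert (by simp)]
        simp
      have hnon : ∀ a b, T / 3 ≤ ∑ i ∈ Finset.Icc a b, peakVar f (p i) (r i) (q i) → a ≤ b := by
        intro a b h
        by_contra hc
        rw [Finset.Icc_eq_empty (by omega), Finset.sum_empty] at h
        linarith
      by_cases hp1 : r 1 - p 1 ≤ 8 * L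
      · by_cases hqm : q m - r m ≤ 8 * L
        · exact ⟨1, m, le_rfl, hm, le_rfl, hp1, hqm, by linarith⟩
        · have e1 := hbig m hm le_rfl (Or.inr (by omega))
          have e2 := hlast 1 hm
          have e3 : T / 3 ≤ ∑ i ∈ Finset.Icc 1 (m - 1), peakVar f (p i) (r i) (q i) := by linarith
          have e4 := hnon _ _ e3
          exact ⟨1, m - 1, le_rfl, e4, by omega, hp1, (hmid (m - 1) (by omega) (by omega)).1, e3⟩
      · have e0 := hbig 1 le_rfl hm (Or.inl (by omega))
        by_cases hqm : q m - r m ≤ 8 * L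
        · have e3 : T / 3 ≤ ∑ i ∈ Finset.Icc 2 m, peakVar f (p i) (r i) (q i) := by linarith
          have e4 := hnon _ _ e3
          exact ⟨2, m, by omega, e4, le_rfl, (hmid 1 (by omega) (by omega)).2, hqm, e3⟩
        · have e1 := hbig m hm le_rfl (Or.inr (by omega))
          have e5 : 2 ≤ m := hnon 2 m (by linarith)
          have e2 := hlast 2 e5
          have e3 : T / 3 ≤ ∑ i ∈ Finset.Icc 2 (m - 1), peakVar f (p i) (r i) (q i) := by linarith
          have e4 := hnon _ _ e3
          exact ⟨2, m - 1, by omega, e4, by omega, (hmid 1 (by omega) (by omega)).2,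
            (hmid (m - 1) (by omega) (by omega)).1, e3⟩
    obtain ⟨a, b, h1, h2, h3, h4, h5, h6⟩ := hab
    have hmem : ∀ i, a ≤ i → i ≤ b → i ∈ Finset.Icc 1 m := fun i hi hi' =>
      Finset.mem_Icc.2 ⟨by omega, by omega⟩
    obtain ⟨s, u, v, t, a1, a2, a3, a4, a5, a6, a7, a8, a9⟩ :=
      near_case f hf hbv L x hL hLeven a b h2 p r q ω
        (fun i hi hi' => (hpk i (hmem i hi hi')).1) (fun i hi hi' => hrad i (hmem i hi hi'))
        (fun i hi hi' => hωlb i (hmem i hi hi')) (fun i hi hi' => hωub i (hmem i hi hi'))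
        (hrx a h1 (by omega)).1 (hrx b (by omega) h3).2 h4 h5
        (fun i hi hi' => hch i (by omega) (by omega))
    exact ⟨s, u, v, t, a1, a2, a3, a4, a5, a6, a7, a8, by linarith⟩

end
end
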